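/- arXiv:math/0403502 — 2 statements merged into one kernel-verified Lean document; each statement's English description precedes it below -/
import Mathlib

section
/- For all positive integers n, the number S_n(12453) of permutations of length n avoiding the pattern 12453 satisfies S_n(12453) < (9 + 4√2)^n. -/
/-- A permutation `p` of length `n` contains the pattern `q` of length `k`:
there are positions `f 0 < f 1 < … < f (k-1)` whose values are order-isomorphic to `q`. -/
def PermContains {n k : ℕ} (p : Equiv.Perm (Fin n)) (q : Equiv.Perm (Fin k)) : Prop :=
  ∃ f : Fin k → Fin n, StrictMono f ∧ ∀ a b : Fin k, p (f a) < p (f b) ↔ q a < q b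

/-- `p` avoids the pattern `q`. -/
def PermAvoids {n k : ℕ} (p : Equiv.Perm (Fin n)) (q : Equiv.Perm (Fin k)) : Prop :=
  ¬ PermContains p q

/-- `avoiders n q` is `S_n(q)`, the number of permutations of length `n` avoiding `q`. -/
noncomputable def avoiders (n : ℕ) {k : ℕ} (q : Equiv.Perm (Fin k)) : ℕ :=
  Nat.card {p : Equiv.Perm (Fin n) // PermAvoids p q}

/-- The pattern 12453 (0-indexed: 0,1,3,4,2). -/
def pat12453 : Equiv.Perm (Fin 5) :=
  ⟨![0, 1, 3, 4, 2], ![0, 1, 4, 2, 3], by decide, by decide⟩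


open Finset

theorem sum_range_sum_antidiagonal_le {f g : ℕ → ℝ} (hf : ∀ k, 0 ≤ f k) (hg : ∀ k, 0 ≤ g k)
    (n : ℕ) : ∑ k ∈ range n, ∑ ij ∈ antidiagonal k, f ij.1 * g ij.2 ≤
      (∑ k ∈ range n, f k) * ∑ k ∈ range n, g k := by
  rw [Finset.sum_mul_sum, ← Finset.sum_product', ← Finset.sum_biUnion]
  · refine Finset.sum_le_sum_of_subset_of_nonneg ?_ fun ij _ _ => mul_nonneg (hf _) (hg _)
    intro ij hij
    simp only [mem_biUnion, mem_range, HasAntidiagonal.mem_antidiagonal] at hij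
    simp only [mem_product, mem_range]
    obtain ⟨k, hk, h⟩ := hij
    omega
  · intro i _ j _ hij
    rw [Function.onFun, Finset.disjoint_left]
    intro x hx hy
    rw [HasAntidiagonal.mem_antidiagonal] at hx hy
    exact hij (hx.symm.trans hy)

/-- The coefficients of `2 - √(4 - 3 * u)` as a power series in `u`. -/
noncomputable def sqrtCoeff : ℕ → ℝ
  | 0 => 0
  | k + 1 => 3 / 4 * (3 / 16) ^ k * catalan k

theorem sqrtCoeff_nonneg (k : ℕ) : 0 ≤ sqrtCoeff k := by
  cases k with
  | zero => simp [sqrtCoeff]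
  | succ k => simp only [sqrtCoeff]; positivity

theorem sum_antidiagonal_sqrtCoeff (k : ℕ) :
    ∑ ij ∈ antidiagonal (k + 2), sqrtCoeff ij.1 * sqrtCoeff ij.2 = 4 * sqrtCoeff (k + 2) := by
  rw [Finset.Nat.sum_antidiagonal_succ, Finset.Nat.sum_antidiagonal_succ']
  simp only [sqrtCoeff, catalan_succ']
  push_cast
  simp only [zero_mul, mul_zero, zero_add]
  rw [Finset.mul_sum, Finset.mul_sum]
  refine Finset.sum_congr rfl fun ij hij => ?_
  rw [← HasAntidiagonal.mem_antidiagonal.1 hij]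
  ring

theorem four_mul_sqrtCoeff_succ_le (k : ℕ) :
    4 * sqrtCoeff (k + 2) ≤ 3 * sqrtCoeff (k + 1) := by
  have h : (catalan (k + 1) : ℝ) ≤ 4 * catalan k := by
    have h1 := succ_mul_catalan_eq_centralBinom k
    have h2 := succ_mul_catalan_eq_centralBinom (k + 1)
    have h3 := Nat.succ_mul_centralBinom_succ k
    rw [← h1, ← h2] at h3
    have h4 : (k + 2) * catalan (k + 1) = 2 * (2 * k + 1) * catalan k := by
      have : 0 < k + 1 := by omega
      apply Nat.eq_of_mul_eq_mul_left this
      linarith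
    have h5 : (k + 2) * catalan (k + 1) ≤ (k + 2) * (4 * catalan k) := by
      rw [h4]; nlinarith [Nat.zero_le (catalan k)]
    exact_mod_cast Nat.le_of_mul_le_mul_left h5 (by omega)
  simp only [sqrtCoeff]
  have : (0 : ℝ) < (3 / 16) ^ k := by positivity
  rw [pow_succ]
  nlinarith

/-- The value of `∑ sqrtCoeff k * x ^ k` is the smaller root `l` of `(2 - l) ^ 2 = 4 - 3 * x`. -/
theorem hasSum_sqrtCoeff {x l : ℝ} (hx : 0 ≤ x) (hl0 : 0 ≤ l) (hl2 : l ≤ 2)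
    (h : 4 * l - l ^ 2 = 3 * x) : HasSum (fun k => sqrtCoeff k * x ^ k) l := by
  set a : ℕ → ℝ := fun k => sqrtCoeff k * x ^ k with ha
  have ha0 : ∀ k, 0 ≤ a k := fun k => mul_nonneg (sqrtCoeff_nonneg k) (pow_nonneg hx k)
  have hconv : ∀ k, ∑ ij ∈ antidiagonal (k + 2), a ij.1 * a ij.2 = 4 * a (k + 2) := by
    intro k
    simp only [ha]
    rw [← mul_assoc, ← sum_antidiagonal_sqrtCoeff, Finset.sum_mul]
    refine Finset.sum_congr rfl fun ij hij => ?_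
    rw [← HasAntidiagonal.mem_antidiagonal.1 hij, pow_add]
    ring
  have ha_zero : a 0 = 0 := by simp [ha, sqrtCoeff]
  have ha_one : a 1 = 3 / 4 * x := by simp [ha, sqrtCoeff]
  have hb : ∀ n, ∑ k ∈ range n, a k ≤ l := by
    intro n
    induction n with
    | zero => simpa
    | succ n ih =>
      rcases n with _ | n
      · simpa [ha_zero]
      have key := sum_range_sum_antidiagonal_le (f := fun k => a (k + 1)) (g := fun k => a (k + 1))
        (fun k => ha0 _) (fun k => ha0 _) n
      have hconv' : ∀ k, ∑ ij ∈ antidiagonal k, a (ij.1 + 1) * a (ij.2 + 1) = 4 * a (k + 2) := by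
        intro k
        rw [← hconv, Finset.Nat.sum_antidiagonal_succ, Finset.Nat.sum_antidiagonal_succ']
        simp [ha_zero]
      simp only [hconv'] at key
      have hS0 : 0 ≤ ∑ k ∈ range n, a (k + 1) := Finset.sum_nonneg fun k _ => ha0 _
      rw [Finset.sum_range_succ', ha_zero] at ih
      rw [Finset.sum_range_succ', Finset.sum_range_succ', ha_zero, ha_one]
      rw [← Finset.mul_sum] at key
      nlinarith
  have hs : Summable a := summable_of_sum_range_le ha0 hb
  have hL : ∑' k, a k ≤ l := Real.tsum_le_of_sum_range_le ha0 hb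
  have hsq : (∑' k, a k) * ∑' k, a k = 4 * (∑' k, a k) - 3 * x := by
    have hn : Summable fun k => ‖a k‖ := hs.norm
    rw [tsum_mul_tsum_eq_tsum_sum_antidiagonal_of_summable_norm hn hn]
    have hsc := summable_norm_sum_mul_antidiagonal_of_summable_norm hn hn
    have hsc := hsc.of_norm
    rw [← hsc.sum_add_tsum_nat_add 2, ← hs.sum_add_tsum_nat_add 2]
    simp_rw [hconv]
    rw [tsum_mul_left]
    simp [Finset.sum_range_succ, ha_zero, ha_one, Finset.Nat.antidiagonal_succ]
    ring
  have : ∑' k, a k = l := by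
    have h1 : (∑' k, a k - l) * (4 - l - ∑' k, a k) = 0 := by nlinarith
    rcases mul_eq_zero.1 h1 with h2 | h2 <;> linarith
  exact this ▸ hs.hasSum

open PowerSeries in
/-- The solution at `x = 1/8` of the functional equations of the indecomposable 1342-avoiders,
scaled by 16: `F` is the generating function by the number of entries above the first one, and `T`
records the tails of `F + T`. -/
theorem exists_powerSeries_solution : ∃ F T : PowerSeries ℝ,
    16 * F = 32 + X * F * (F + T) ∧
    32 * X * T + 16 = 32 * T + 5 * X * (F + T) ∧
    (∀ m, coeff m F = 4 * sqrtCoeff (m + 1) - (1 - ∑ k ∈ range (m + 1), sqrtCoeff k)) ∧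
    (∀ m, (32 / 27) ^ m * coeff m T = (32 / 27) ^ m * (1 - ∑ k ∈ range (m + 1), sqrtCoeff k) -
      3 / 8 * (4 / 3 - ∑ k ∈ range (m + 1), sqrtCoeff k * (32 / 27) ^ k)) := by
  obtain ⟨f, hf⟩ : ∃ f : PowerSeries ℝ, f = PowerSeries.mk sqrtCoeff := ⟨_, rfl⟩
  have hfc : ∀ m, coeff m f = sqrtCoeff m := by simp [hf]
  have hf0 : constantCoeff f = 0 := by
    rw [← coeff_zero_eq_constantCoeff_apply, hfc]; simp [sqrtCoeff]
  have h2n : constantCoeff (2 : PowerSeries ℝ) = 2 := map_ofNat _ 2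
  have h3n : constantCoeff (3 : PowerSeries ℝ) = 3 := map_ofNat _ 3
  have hC : ∀ n : ℕ, [n.AtLeastTwo] → (ofNat(n) : PowerSeries ℝ) = C (ofNat(n) : ℝ) :=
    fun n _ => (map_ofNat C n).symm
  have hff : f * f = 4 * f - 3 * X := by
    ext m
    rw [map_sub, coeff_mul, hC 4,
      hC 3, coeff_C_mul, coeff_C_mul, coeff_X]
    simp only [hfc]
    rcases m with _ | _ | m
    · simp [sqrtCoeff]
    · simp [sqrtCoeff, Finset.Nat.antidiagonal_succ]; norm_num
    · rw [sum_antidiagonal_sqrtCoeff]; simp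
  obtain ⟨t, ht⟩ : ∃ t : PowerSeries ℝ, t = 2 - f := ⟨_, rfl⟩
  have htt : t ^ 2 = 4 - 3 * X := by rw [ht]; linear_combination hff
  have ht0 : constantCoeff t = 2 := by simp [ht, hf0, h2n]
  have hg1 := PowerSeries.mul_inv_cancel (1 + t) (by simp [ht0]; norm_num)
  have hg2 := PowerSeries.mul_inv_cancel (2 + t) (by simp [ht0, h2n])
  have hg3 := PowerSeries.mul_inv_cancel (3 * t + 2) (by simp [ht0, h2n, h3n]; norm_num)
  have hc3 : constantCoeff (3 * t + 2)⁻¹ = 1 / 8 := by simp [ht0, h2n, h3n]; norm_num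
  have hc1 : constantCoeff (1 + t)⁻¹ = 1 / 3 := by simp [ht0]; norm_num
  generalize (1 + t)⁻¹ = g1 at hg1 hc1
  generalize (2 + t)⁻¹ = g2 at hg2
  generalize (3 * t + 2)⁻¹ = g3 at hg3 hc3
  have hF : 12 * g2 - 3 * g1 = 3 * (3 * t + 2) * g1 * g2 := by
    linear_combination (-12 * g2) * hg1 + 3 * g1 * hg2
  have hT : 3 * g1 - 4 * g3 = (5 * t + 2) * g1 * g3 := by
    linear_combination (-3 * g1) * hg3 + 4 * g3 * hg1
  have hS : 12 * g2 - 4 * g3 = 16 * (2 * t + 1) * g2 * g3 := by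
    linear_combination (-12 * g2) * hg3 + 4 * g3 * hg2
  have hS' : (12 * g2 - 3 * g1) + (3 * g1 - 4 * g3) = 16 * (2 * t + 1) * g2 * g3 := by
    rw [← hS]; ring
  have h3 : (3 : PowerSeries ℝ) ≠ 0 := by
    rw [hC 3]
    simp
  have h2 : 3 * X * g2 = f := by
    have : (3 * X : PowerSeries ℝ) = (2 + t) * (2 - t) := by linear_combination htt
    rw [this, ht] at *
    linear_combination f * hg2
  have h1 : 3 * (X - 1) * g1 = f - 1 := by
    have : (3 * (X - 1) : PowerSeries ℝ) = (1 + t) * (1 - t) := by linear_combination htt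
    rw [this, ht] at *
    linear_combination (f - 1) * hg1
  have h33 : (32 - 27 * X) * g3 = 4 - 3 * f := by
    have : (32 - 27 * X : PowerSeries ℝ) = (3 * t + 2) * (3 * t - 2) := by
      linear_combination (-9) * htt
    rw [this, ht] at *
    linear_combination (4 - 3 * f) * hg3
  have hR : ∀ m, 3 * coeff m g1 = 1 - ∑ k ∈ range (m + 1), sqrtCoeff k := by
    intro m
    induction m with
    | zero => simp [sqrtCoeff, hc1]
    | succ m ih =>
      have := congrArg (coeff (m + 1)) h1
      rw [show 3 * (X - 1) * g1 = C 3 * (X * g1) - C 3 * g1 by rw [← hC 3]; ring] at this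
      simp only [map_sub, coeff_C_mul, coeff_succ_X_mul, hfc, coeff_one] at this
      simp only [Nat.add_eq_zero_iff, one_ne_zero, and_false, if_false] at this
      rw [Finset.sum_range_succ]
      linarith
  refine ⟨12 * g2 - 3 * g1, 3 * g1 - 4 * g3, ?_, ?_, ?_, ?_⟩
  · apply mul_left_cancel₀ h3
    rw [hS', hF]
    have : (3 * X : PowerSeries ℝ) = (2 + t) * (2 - t) := by linear_combination htt
    linear_combination
      (-(3 * (3 * t + 2) * g1 * g2 * (16 * (2 * t + 1) * g2 * g3))) * this
      - 48 * (2 - t) * (2 * t + 1) * g1 * g2 * (hg2 + (2 + t) * g2 * hg3)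
      + 96 * hg1 + 96 * (1 + t) * g1 * hg2
  · apply mul_left_cancel₀ h3
    rw [hS', hT]
    have : (3 * X : PowerSeries ℝ) = (2 + t) * (2 - t) := by linear_combination htt
    linear_combination
      (32 * ((5 * t + 2) * g1 * g3) - 5 * (16 * (2 * t + 1) * g2 * g3)) * this
      + 32 * (1 - t) * (5 * t + 2) * g3 * hg1 - 80 * (2 - t) * (2 * t + 1) * g3 * hg2 - 48 * hg3
  · intro m
    rw [← hR]
    have := congrArg (coeff (m + 1)) h2
    rw [show 3 * X * g2 = C 3 * (X * g2) by rw [← hC 3]; ring] at this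
    simp only [coeff_C_mul, coeff_succ_X_mul, hfc] at this
    rw [show 12 * g2 - 3 * g1 = C 12 * g2 - C 3 * g1 by rw [← hC 12, ← hC 3], map_sub, coeff_C_mul,
      coeff_C_mul]
    linarith
  · have hg3c : ∀ m, (32 / 27) ^ m * coeff m g3 =
        3 / 32 * (4 / 3 - ∑ k ∈ range (m + 1), sqrtCoeff k * (32 / 27) ^ k) := by
      intro m
      induction m with
      | zero => simp [sqrtCoeff, hc3]; norm_num
      | succ m ih =>
        have := congrArg (coeff (m + 1)) h33
        rw [show (32 - 27 * X) * g3 = C 32 * g3 - C 27 * (X * g3) by rw [← hC 32, ← hC 27]; ring,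
          show 4 - 3 * f = C 4 - C 3 * f by rw [← hC 4, ← hC 3]] at this
        simp only [map_sub, coeff_C_mul, coeff_succ_X_mul, hfc, coeff_C] at this
        simp only [Nat.add_eq_zero_iff, one_ne_zero, and_false, if_false] at this
        rw [Finset.sum_range_succ, mul_sub, mul_add, ← sub_sub, ← mul_sub, ← ih, pow_succ]
        linear_combination (32 / 27 : ℝ) ^ m / 27 * this
    intro m
    rw [← hR, show 3 * g1 - 4 * g3 = C 3 * g1 - C 4 * g3 by rw [← hC 3, ← hC 4], map_sub, coeff_C_mul,
      coeff_C_mul]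
    linear_combination (-4) * hg3c m

theorem exists_solution : ∃ a b : ℕ → ℝ, (∀ m, 0 ≤ a m) ∧ (∀ m, 0 ≤ b m) ∧ a 0 = 1 / 8 ∧
    (∀ m, a (m + 1) = ∑ ij ∈ antidiagonal m, a ij.1 * (a ij.2 + b ij.2)) ∧
    (∀ m, b m - b (m + 1) = 5 / 32 * (a m + b m)) ∧ ∀ n, ∑ m ∈ range n, a m ≤ 5 / 32 := by
  obtain ⟨F, T, h1, h2, h3, h4⟩ := exists_powerSeries_solution
  have hC : ∀ n : ℕ, [n.AtLeastTwo] → (ofNat(n) : PowerSeries ℝ) = PowerSeries.C (ofNat(n) : ℝ) :=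
    fun n _ => (map_ofNat PowerSeries.C n).symm
  obtain ⟨a, ha⟩ : ∃ a : ℕ → ℝ, ∀ m, PowerSeries.coeff m F = 16 * a m :=
    ⟨fun m => PowerSeries.coeff m F / 16, fun m => by ring⟩
  obtain ⟨b, hb⟩ : ∃ b : ℕ → ℝ, ∀ m, PowerSeries.coeff m T = 16 * b m :=
    ⟨fun m => PowerSeries.coeff m T / 16, fun m => by ring⟩
  have ha0 : a 0 = 1 / 8 := by
    have := h3 0
    rw [ha] at this
    simp [sqrtCoeff] at this
    linarith
  have hb0 : b 0 = 1 / 32 := by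
    have := h4 0
    rw [hb] at this
    simp [sqrtCoeff] at this
    linarith
  have hrec : ∀ m, a (m + 1) = ∑ ij ∈ antidiagonal m, a ij.1 * (a ij.2 + b ij.2) := by
    intro m
    have := congrArg (PowerSeries.coeff (m + 1)) h1
    rw [hC 16, hC 32, mul_assoc, map_add, PowerSeries.coeff_C_mul, PowerSeries.coeff_succ_X_mul,
      PowerSeries.coeff_mul, ha, PowerSeries.coeff_C] at this
    simp only [map_add, ha, hb, Nat.add_eq_zero_iff, one_ne_zero, and_false, if_false,
      zero_add] at this
    have h5 : ∑ ij ∈ antidiagonal m, 16 * a ij.1 * (16 * a ij.2 + 16 * b ij.2) =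
        256 * ∑ ij ∈ antidiagonal m, a ij.1 * (a ij.2 + b ij.2) := by
      rw [Finset.mul_sum]
      exact Finset.sum_congr rfl fun _ _ => by ring
    linarith
  have htail : ∀ m, b m - b (m + 1) = 5 / 32 * (a m + b m) := by
    intro m
    have := congrArg (PowerSeries.coeff (m + 1)) h2
    rw [hC 16, hC 32, hC 5, mul_assoc, mul_assoc, map_add, map_add, PowerSeries.coeff_C_mul,
      PowerSeries.coeff_C_mul, PowerSeries.coeff_C_mul,
      PowerSeries.coeff_succ_X_mul, PowerSeries.coeff_succ_X_mul, PowerSeries.coeff_C] at this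
    simp only [map_add, ha, hb, Nat.add_eq_zero_iff, one_ne_zero, and_false, if_false] at this
    linarith
  have hsum1 : HasSum sqrtCoeff 1 := by
    simpa using hasSum_sqrtCoeff (x := 1) (l := 1) (by norm_num) (by norm_num) (by norm_num)
      (by norm_num)
  have hlim1 := (hsum1.tendsto_sum_nat).comp (Filter.tendsto_add_atTop_nat 1)
  have hsum2 := hasSum_sqrtCoeff (x := 32 / 27) (l := 4 / 3) (by norm_num) (by norm_num)
    (by norm_num) (by norm_num)
  have hlim2 := (hsum2.tendsto_sum_nat).comp (Filter.tendsto_add_atTop_nat 1)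
  have hR : ∀ m, ∑ k ∈ range m, sqrtCoeff k ≤ 1 := fun m =>
    sum_le_hasSum _ (fun k _ => sqrtCoeff_nonneg k) hsum1
  have ha_anti : Antitone a := by
    refine antitone_nat_of_succ_le fun m => ?_
    have h5 := h3 m
    have h6 := h3 (m + 1)
    rw [Finset.sum_range_succ, ha] at h6
    rw [ha] at h5
    linarith [four_mul_sqrtCoeff_succ_le m]
  have ha_nonneg : ∀ m, 0 ≤ a m := by
    intro m
    have hl : Filter.Tendsto (fun n => -(1 - ∑ k ∈ range (n + 1), sqrtCoeff k) / 16)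
        Filter.atTop (nhds 0) := by
      simpa using ((hlim1.const_sub 1).neg).div_const 16
    refine le_of_tendsto hl ?_
    filter_upwards [Filter.eventually_ge_atTop m] with n hn
    have h5 := h3 n
    rw [ha] at h5
    linarith [ha_anti hn, sqrtCoeff_nonneg (n + 1)]
  have hb_anti : Antitone fun m => (32 / 27) ^ m * b m := by
    refine antitone_nat_of_succ_le fun m => ?_
    have h5 : 32 * b (m + 1) ≤ 27 * b m := by linarith [htail m, ha_nonneg m]
    have h6 : (0 : ℝ) < (32 / 27) ^ m := by positivity
    simp only [pow_succ]
    nlinarith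
  have hb_nonneg : ∀ m, 0 ≤ b m := by
    intro m
    have h6 : (0 : ℝ) < (32 / 27) ^ m := by positivity
    refine nonneg_of_mul_nonneg_right ?_ h6
    have hl : Filter.Tendsto (fun n => -(3 / 8 *
        (4 / 3 - ∑ k ∈ range (n + 1), sqrtCoeff k * (32 / 27) ^ k)) / 16)
        Filter.atTop (nhds 0) := by
      have h := (((hlim2.const_sub (4 / 3)).const_mul (3 / 8)).neg).div_const 16
      rwa [sub_self, mul_zero, neg_zero, zero_div] at h
    refine le_of_tendsto hl ?_
    filter_upwards [Filter.eventually_ge_atTop m] with n hn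
    have h5 := h4 n
    rw [hb] at h5
    have h7 : (0 : ℝ) ≤ (32 / 27) ^ n * (1 - ∑ k ∈ range (n + 1), sqrtCoeff k) :=
      mul_nonneg (by positivity) (by linarith [hR (n + 1)])
    have h8 := hb_anti hn
    simp only at h8
    linarith
  have hab : ∀ n, ∑ m ∈ range n, (a m + b m) ≤ 1 / 5 := by
    intro n
    have : 5 / 32 * ∑ m ∈ range n, (a m + b m) = b 0 - b n := by
      rw [← Finset.sum_range_sub', Finset.mul_sum]
      exact Finset.sum_congr rfl fun m _ => (htail m).symm
    linarith [hb_nonneg n]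
  refine ⟨a, b, ha_nonneg, hb_nonneg, ha0, hrec, htail, fun n => ?_⟩
  induction n with
  | zero => norm_num
  | succ n ih =>
    rw [Finset.sum_range_succ', ha0]
    simp only [hrec]
    have h5 := sum_range_sum_antidiagonal_le ha_nonneg
      (fun k => add_nonneg (ha_nonneg k) (hb_nonneg k)) n
    have h6 : 0 ≤ ∑ m ∈ range n, a m := Finset.sum_nonneg fun m _ => ha_nonneg m
    nlinarith [hab n]

/-- A word containing no subword `a b c d` with `a < d < b < c`. -/
def AvoidsList (l : List ℕ) : Prop :=
  ∀ a b c d, List.Sublist [a, b, c, d] l → a < d → d < b → ¬ b < c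

/-- A word that is not the concatenation of two nonempty words of which the first lies weakly
above the second. -/
def SkewIndecomposable (l : List ℕ) : Prop :=
  ∀ s t, l = s ++ t → s ≠ [] → t ≠ [] → ∃ x ∈ s, ∃ y ∈ t, x < y

/-- The one-line notation of a permutation of `{0, …, l.length - 1}`. -/
def IsStandard (l : List ℕ) : Prop := l.Nodup ∧ ∀ x ∈ l, x < l.length

/-- A nonempty skew-indecomposable 1342-avoiding permutation. -/
structure IsBlock (l : List ℕ) : Prop where
  ne_nil : l ≠ []
  std : IsStandard l
  avoids : AvoidsList l
  indec : SkewIndecomposable l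

/-- A block in which all entries between the first one and the maximum are smaller than the
first one. -/
structure IsPointed (l : List ℕ) : Prop extends IsBlock l where
  two_le : 2 ≤ l.length
  lt_head : ∀ f s M t, l = f :: (s ++ M :: t) → (∀ x ∈ l, x ≤ M) → ∀ x ∈ s, x < f

/-- Replace the first entry of `q` by a copy of `A`. -/
def inflate (A q : List ℕ) : List ℕ :=
  A.map (· + q.headI) ++ q.tail.map fun v => if v < q.headI then v else v + (A.length - 1)

theorem AvoidsList.sublist {l l' : List ℕ} (h : AvoidsList l) (hl : List.Sublist l' l) :
    AvoidsList l' :=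
  fun a b c d hs => h a b c d (hs.trans hl)

theorem AvoidsList.map {l : List ℕ} (h : AvoidsList l) {g : ℕ → ℕ}
    (hg : ∀ x ∈ l, ∀ y ∈ l, x < y → g x < g y) : AvoidsList (l.map g) := by
  have hg' : ∀ x ∈ l, ∀ y ∈ l, g x < g y → x < y := by
    intro x hx y hy hxy
    by_contra hn
    rcases (not_lt.1 hn).eq_or_lt with h1 | h1
    · rw [h1] at hxy; exact lt_irrefl _ hxy
    · exact lt_asymm hxy (hg y hy x hx h1)
  intro a b c d hs had hdb hbc
  obtain ⟨l', hl', heq⟩ := List.sublist_map_iff.1 hs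
  match l', heq with
  | [a', b', c', d'], heq =>
    simp only [List.map_cons, List.map_nil, List.cons.injEq, and_true] at heq
    obtain ⟨rfl, rfl, rfl, rfl⟩ := heq
    have hm : ∀ x ∈ [a', b', c', d'], x ∈ l := fun x hx => hl'.subset hx
    exact h _ _ _ _ hl' (hg' _ (hm _ (by simp)) _ (hm _ (by simp)) had)
      (hg' _ (hm _ (by simp)) _ (hm _ (by simp)) hdb)
      (hg' _ (hm _ (by simp)) _ (hm _ (by simp)) hbc)

theorem SkewIndecomposable.map {l : List ℕ} (h : SkewIndecomposable l) {g : ℕ → ℕ}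
    (hg : ∀ x ∈ l, ∀ y ∈ l, x < y → g x < g y) : SkewIndecomposable (l.map g) := by
  intro s t hst hs ht
  obtain ⟨s', t', rfl, rfl, rfl⟩ := List.map_eq_append_iff.1 hst
  obtain ⟨x, hx, y, hy, hxy⟩ := h s' t' rfl (by simpa using hs) (by simpa using ht)
  exact ⟨g x, List.mem_map_of_mem hx, g y, List.mem_map_of_mem hy,
    hg x (by simp [hx]) y (by simp [hy]) hxy⟩

theorem List.Nodup.map_of_lt {l : List ℕ} (h : l.Nodup) {g : ℕ → ℕ}
    (hg : ∀ x ∈ l, ∀ y ∈ l, x < y → g x < g y) : (l.map g).Nodup := by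
  refine h.map_on fun x hx y hy hxy => ?_
  rcases lt_trichotomy x y with h1 | h1 | h1
  · exact absurd hxy (hg x hx y hy h1).ne
  · exact h1
  · exact absurd hxy (hg y hy x hx h1).ne'

theorem IsStandard.mem_iff {l : List ℕ} (h : IsStandard l) {x : ℕ} : x ∈ l ↔ x < l.length := by
  have h1 : l.toFinset = range l.length := by
    apply Finset.eq_of_subset_of_card_le
    · intro y hy
      simpa using h.2 y (by simpa using hy)
    · rw [List.toFinset_card_of_nodup h.1, card_range]
  rw [← List.mem_toFinset, h1, mem_range]

theorem exists_skewIndecomposable_prefix {l : List ℕ} (hl : l ≠ []) :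
    ∃ s t, l = s ++ t ∧ s ≠ [] ∧ SkewIndecomposable s ∧ ∀ x ∈ s, ∀ y ∈ t, ¬ x < y := by
  induction hn : l.length using Nat.strong_induction_on generalizing l with
  | _ n ih =>
    by_cases h : SkewIndecomposable l
    · exact ⟨l, [], by simp, hl, h, by simp⟩
    · simp only [SkewIndecomposable] at h
      push Not at h
      obtain ⟨s, t, rfl, hs, ht, hst⟩ := h
      have : 0 < t.length := List.length_pos_iff.2 ht
      obtain ⟨s', t', rfl, hs', hind, hlt⟩ := ih s.length (by simp at hn; omega) hs rfl
      refine ⟨s', t' ++ t, by simp, hs', hind, fun x hx y hy => ?_⟩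
      rcases List.mem_append.1 hy with hy | hy
      · exact hlt x hx y hy
      · exact not_lt.2 (hst x (by simp [hx]) y hy)

theorem exists_mem_iff_of_convex {s : List ℕ} (hs : s.Nodup) (hne : s ≠ [])
    (hconv : ∀ x ∈ s, ∀ y ∈ s, ∀ z, x < z → z < y → z ∈ s) :
    ∃ f ∈ s, ∀ x, x ∈ s ↔ f ≤ x ∧ x < f + s.length := by
  have hne' : s.toFinset.Nonempty := by simpa using hne
  obtain ⟨f, hf, hfmin⟩ := s.toFinset.exists_min_image id hne'
  obtain ⟨g, hg, hgmax⟩ := s.toFinset.exists_max_image id hne'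
  simp only [List.mem_toFinset, id] at hf hfmin hg hgmax
  have h1 : s.toFinset = Icc f g := by
    ext z
    simp only [List.mem_toFinset, mem_Icc]
    refine ⟨fun hz => ⟨hfmin z hz, hgmax z hz⟩, fun ⟨h2, h3⟩ => ?_⟩
    rcases h2.eq_or_lt with rfl | h2
    · exact hf
    rcases h3.eq_or_lt with rfl | h3
    · exact hg
    exact hconv f hf g hg z h2 h3
  have h2 : s.length = g + 1 - f := by
    rw [← List.toFinset_card_of_nodup hs, h1, Nat.card_Icc]
  have h3 := hfmin g hg
  refine ⟨f, hf, fun x => ?_⟩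
  rw [← List.mem_toFinset, h1, mem_Icc]
  omega

theorem List.exists_append_max {l : List ℕ} (hl : l ≠ []) :
    ∃ s M t, l = s ++ M :: t ∧ ∀ x ∈ l, x ≤ M := by
  obtain ⟨M, hM, hmax⟩ := l.toFinset.exists_max_image id (by simpa using hl)
  simp only [List.mem_toFinset, id] at hM hmax
  obtain ⟨s, t, rfl⟩ := List.append_of_mem hM
  exact ⟨s, M, t, rfl, hmax⟩

/-- In a 1342-avoiding word, no later entry `v` splits the values of a skew-indecomposable word
`s` preceding the maximum `M`. -/
theorem AvoidsList.lt_or_gt_of_indec {s t u : List ℕ} {M v : ℕ}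
    (h : AvoidsList (s ++ t ++ M :: u)) (hs : SkewIndecomposable s) (hmax : ∀ x ∈ s, x < M)
    (hv : v ∈ u) (hvs : v ∉ s) : (∀ x ∈ s, v < x) ∨ ∀ x ∈ s, x < v := by
  have hsplit : s = s.takeWhile (v < ·) ++ s.dropWhile (v < ·) := by simp
  have hlt : ∀ x ∈ s.takeWhile (v < ·), v < x := fun x hx => by
    simpa using List.mem_takeWhile_imp hx
  generalize s.takeWhile (v < ·) = s₁ at hsplit hlt
  rcases hd : s.dropWhile (v < ·) with _ | ⟨x, s₂⟩
  · left
    rw [hsplit, hd]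
    simpa using hlt
  right
  have hx : ¬ v < x := by
    have := List.head_dropWhile_not (l := s) (fun x => decide (v < x)) (by rw [hd]; simp)
    simpa [hd] using this
  rw [hd] at hsplit
  have hxs : x ∈ s := by rw [hsplit]; simp
  have hxv : x < v := lt_of_le_of_ne (not_lt.1 hx) fun h => hvs (h ▸ hxs)
  have hs₂ : ∀ y ∈ s₂, ¬ v < y := by
    intro y hy hvy
    refine h x y M v ?_ hxv hvy (hmax y (by rw [hsplit]; simp [hy]))
    have h1 : List.Sublist [x, y] s := by
      rw [hsplit]
      exact ((List.singleton_sublist.2 hy).cons_cons x).trans (List.sublist_append_right _ _)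
    have h2 : List.Sublist [M, v] (M :: u) := (List.singleton_sublist.2 hv).cons_cons M
    exact (h1.trans (List.sublist_append_left _ _)).append h2
  have hs₁ : s₁ = [] := by
    by_contra hne
    obtain ⟨a, ha, b, hb, hab⟩ := hs s₁ (x :: s₂) hsplit hne (by simp)
    have := hlt a ha
    rcases List.mem_cons.1 hb with rfl | hb
    · omega
    · exact hs₂ b hb (by omega)
  intro y hy
  have hyv : y ≠ v := fun h => hvs (h ▸ hy)
  rw [hsplit, hs₁] at hy
  rcases List.mem_cons.1 hy with rfl | hy
  · exact hxv
  · have := hs₂ y hy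
    omega

/-- Every block with at least two entries is an inflation of a pointed block by a block, and the
inflated part precedes the maximum. -/
theorem IsBlock.exists_inflate {p : List ℕ} (hp : IsBlock p) (h2 : 2 ≤ p.length) :
    ∃ A q, IsBlock A ∧ IsPointed q ∧ p = inflate A q ∧ p.length + 1 = A.length + q.length ∧
      p.headI = A.headI + q.headI ∧
      ∃ s M t, p = A.map (· + q.headI) ++ s ++ M :: t ∧ ∀ x ∈ p, x ≤ M := by
  obtain ⟨A', M, B, hpAB, hmax⟩ := List.exists_append_max hp.ne_nil
  have hA' : A' ≠ [] := by
    rintro rfl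
    have hB : B ≠ [] := by
      rintro rfl
      simp [hpAB] at h2
    obtain ⟨x, hx, y, hy, hxy⟩ := hp.indec [M] B (by simpa using hpAB) (by simp) hB
    have := hmax y (by rw [hpAB]; simp [hy])
    simp at hx
    omega
  obtain ⟨S, R, rfl, hS, hSind, hSR⟩ := exists_skewIndecomposable_prefix hA'
  have hnd := hp.std.1
  rw [hpAB] at hnd
  have hSp : ∀ x ∈ S, x ∈ p := fun x hx => by rw [hpAB]; simp [hx]
  have hSM : ∀ x ∈ S, x < M := by
    intro x hx
    refine lt_of_le_of_ne (hmax x (hSp x hx)) ?_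
    rintro rfl
    exact (List.nodup_append.1 hnd).2.2 x (by simp [hx]) x (by simp) rfl
  obtain ⟨Q, hQ⟩ : ∃ Q, Q = R ++ M :: B := ⟨_, rfl⟩
  have hpQ : p = S ++ Q := by rw [hpAB, hQ]; simp
  have hnd' : (S ++ Q).Nodup := hpQ ▸ hp.std.1
  have hdisj : ∀ x ∈ S, x ∉ Q := fun x hx hy => (List.nodup_append.1 hnd').2.2 x hx x hy rfl
  have hside : ∀ v ∈ Q, (∀ x ∈ S, v < x) ∨ ∀ x ∈ S, x < v := by
    intro v hv
    have hvS : v ∉ S := fun h => hdisj v h hv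
    rw [hQ, List.mem_append, List.mem_cons] at hv
    rcases hv with hv | rfl | hv
    · left
      intro x hx
      refine lt_of_le_of_ne (not_lt.1 (hSR x hx v hv)) ?_
      rintro rfl
      exact hvS hx
    · exact Or.inr hSM
    · exact (hpAB ▸ hp.avoids).lt_or_gt_of_indec hSind hSM hv hvS
  obtain ⟨f, hf, hmem⟩ := exists_mem_iff_of_convex (List.nodup_append.1 hnd').1 hS (by
    intro x hx y hy z hxz hzy
    have hz : z ∈ p := hp.std.mem_iff.2 (hzy.trans (hp.std.2 y (hSp y hy)))
    rw [hpQ, List.mem_append] at hz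
    refine hz.resolve_right fun hz => ?_
    rcases hside z hz with h | h
    · exact lt_asymm hxz (h x hx)
    · exact lt_asymm hzy (h y hy))
  have hSpos : 0 < S.length := List.length_pos_iff.2 hS
  have hQf : ∀ v ∈ Q, v < f ∨ f + S.length ≤ v := by
    intro v hv
    by_contra! h
    exact hdisj v ((hmem v).2 h) hv
  have hlen : p.length = S.length + Q.length := by rw [hpQ, List.length_append]
  set c : ℕ → ℕ := fun v => if v ≤ f then v else v - (S.length - 1) with hc
  have hcf : c f = f := by simp [hc]
  have hfQ : ∀ x ∈ f :: Q, x ≤ f ∨ f + S.length ≤ x := by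
    intro x hx
    rcases List.mem_cons.1 hx with rfl | hx
    · exact Or.inl le_rfl
    · exact (hQf x hx).imp le_of_lt id
  have hcmono : ∀ x ∈ f :: Q, ∀ y ∈ f :: Q, x < y → c x < c y := by
    intro x hx y hy hxy
    have h1 := hfQ x hx
    have h2 := hfQ y hy
    simp only [hc]
    split_ifs <;> omega
  have hq : f :: Q.map c = (f :: Q).map c := by rw [List.map_cons, hcf]
  have hsub : List.Sublist (f :: Q) p := by
    rw [hpQ]
    exact (List.singleton_sublist.2 hf).append (List.Sublist.refl Q)
  have hfp : ∀ x ∈ f :: Q, x < p.length := fun x hx => hp.std.2 x (hsub.subset hx)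
  have hsmono : ∀ x ∈ S, ∀ y ∈ S, x < y → x - f < y - f := by
    intro x hx y hy hxy
    have := (hmem x).1 hx
    omega
  have hQne : Q ≠ [] := by rw [hQ]; simp
  have hQpos : 0 < Q.length := List.length_pos_iff.2 hQne
  have hmapS : (S.map (· - f)).map (· + f) = S := by
    rw [List.map_map]
    conv_rhs => rw [← List.map_id S]
    refine List.map_congr_left fun x hx => ?_
    have := (hmem x).1 hx
    simp only [Function.comp, id]
    omega
  have hblock : IsBlock (f :: Q.map c) := by
    refine ⟨by simp, ⟨?_, ?_⟩, ?_, ?_⟩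
    · rw [hq]; exact (hp.std.1.sublist hsub).map_of_lt hcmono
    · intro x hx
      rw [hq, List.mem_map] at hx
      obtain ⟨y, hy, rfl⟩ := hx
      have h1 := hfp y hy
      have h2 := hfQ y hy
      have h3 := (hmem (f + S.length - 1)).2 (by omega)
      have h4 : f + S.length - 1 < p.length := hp.std.2 _ (hSp _ h3)
      have h5 : y ≤ f → y < f + 1 := by omega
      simp only [List.length_cons, List.length_map, hc]
      split_ifs
      · by_contra hcon
        omega
      · omega
    · rw [hq]; exact (hp.avoids.sublist hsub).map hcmono
    · rw [hq]
      refine SkewIndecomposable.map ?_ hcmono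
      intro s t hst hs ht
      obtain ⟨a, s, rfl⟩ := List.exists_cons_of_ne_nil hs
      simp only [List.cons_append, List.cons.injEq] at hst
      obtain ⟨rfl, rfl⟩ := hst
      obtain ⟨x, hx, y, hy, hxy⟩ := hp.indec (S ++ s) t (by simp [hpQ]) (by simp [hS]) ht
      rcases List.mem_append.1 hx with hx | hx
      · refine ⟨f, by simp, y, hy, ?_⟩
        rcases hside y (by simp [hy]) with h | h
        · exact absurd hxy (lt_asymm (h x hx))
        · exact h f hf
      · exact ⟨x, by simp [hx], y, hy, hxy⟩
  refine ⟨S.map (· - f), f :: Q.map c, ⟨by simpa using hS, ⟨?_, ?_⟩, ?_, ?_⟩,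
    ⟨hblock, ?_, ?_⟩, ?_, ?_, ?_, ?_⟩
  · exact (List.nodup_append.1 hnd').1.map_of_lt hsmono
  · intro x hx
    obtain ⟨y, hy, rfl⟩ := List.mem_map.1 hx
    have := (hmem y).1 hy
    simp only [List.length_map]
    omega
  · exact (hp.avoids.sublist (hpQ ▸ List.sublist_append_left S Q)).map hsmono
  · exact hSind.map hsmono
  · simp only [List.length_cons, List.length_map]
    omega
  · intro f' s M' t heq hM' x hx
    simp only [List.cons.injEq] at heq
    obtain ⟨rfl, heq⟩ := heq
    obtain ⟨s', u, hQs, rfl, hu⟩ := List.map_eq_append_iff.1 heq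
    obtain ⟨m', t', rfl, rfl, rfl⟩ := List.map_eq_cons_iff.1 hu
    obtain ⟨y, hy, rfl⟩ := List.mem_map.1 hx
    have hm'M : m' = M := by
      have hm'Q : m' ∈ Q := by rw [hQs]; simp
      have hMQ : M ∈ Q := by rw [hQ]; simp
      refine le_antisymm (hmax m' (by rw [hpQ]; simp [hm'Q])) (not_lt.1 fun hlt => ?_)
      have h1 := hcmono m' (by simp [hm'Q]) M (by simp [hMQ]) hlt
      have h2 := hM' (c M) (List.mem_cons_of_mem _ (List.mem_map_of_mem hMQ))
      omega
    subst hm'M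
    have hsR : s' = R := by
      have hndQ : Q.Nodup := (List.nodup_append.1 hnd').2.1
      rw [hQs] at hQ
      rw [hQs] at hndQ
      exact (List.append_cons_inj_of_notMem
        (fun h => (List.nodup_append.1 hndQ).2.2 m' h m' (by simp) rfl)
        (List.nodup_cons.1 (List.nodup_append.1 hndQ).2.1).1
        |>.1 hQ).1
    rw [hsR] at hy
    have hyQ : y ∈ Q := by rw [hQ]; simp [hy]
    have h1 : y < f := by
      refine lt_of_le_of_ne (not_lt.1 (hSR f hf y hy)) ?_
      rintro rfl
      exact hdisj y hf hyQ
    have h2 := hcmono y (by simp [hyQ]) f (by simp) h1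
    rwa [hcf] at h2
  · rw [inflate]
    simp only [List.headI_cons, List.tail_cons, List.length_map]
    rw [hmapS, List.map_map, hpQ]
    congr 1
    conv_lhs => rw [← List.map_id Q]
    refine List.map_congr_left fun x hx => ?_
    have := hQf x hx
    simp only [Function.comp, id, hc]
    split_ifs <;> omega
  · simp only [List.length_cons, List.length_map]
    omega
  · obtain ⟨a, S', rfl⟩ := List.exists_cons_of_ne_nil hS
    have := (hmem a).1 (by simp)
    rw [hpQ]
    simp only [List.cons_append, List.headI_cons, List.map_cons]
    omega
  · refine ⟨R, M, B, ?_, hmax⟩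
    rw [List.headI_cons, hmapS, hpAB]

/-- Insert an entry with `h` larger entries in front of a permutation. -/
def prependWith (h : ℕ) (l : List ℕ) : List ℕ :=
  (l.length - h) :: l.map fun v => if v < l.length - h then v else v + 1

/-- Insert the maximum right after the first entry. -/
def insertMax (l : List ℕ) : List ℕ := l.headI :: l.length :: l.tail

/-- The structure of pointed blocks. -/
theorem IsPointed.exists_insertMax_or_prependWith {p : List ℕ} (hp : IsPointed p) :
    (∃ r, IsBlock r ∧ p = insertMax r) ∨
      ∃ A q, IsBlock A ∧ IsPointed q ∧ p = prependWith (p.length - 1 - p.headI) (inflate A q) ∧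
        p.length = A.length + q.length ∧
        p.length - 1 - p.headI ≤ q.length - 1 - q.headI := by
  obtain ⟨f, Q, rfl⟩ := List.exists_cons_of_ne_nil hp.ne_nil
  have hnd := List.nodup_cons.1 hp.std.1
  have hQne : Q ≠ [] := by
    rintro rfl
    simpa using hp.two_le
  have hlt : ∀ x ∈ f :: Q, x < Q.length + 1 := by simpa using hp.std.2
  have hmem : ∀ x, x ∈ f :: Q ↔ x < Q.length + 1 := by simpa using fun x => hp.std.mem_iff (x := x)
  obtain ⟨s, M, t, hQ, hM⟩ := List.exists_append_max hQne
  have hfM : f < M := by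
    obtain ⟨x, hx, y, hy, hxy⟩ := hp.indec [f] Q rfl (by simp) hQne
    rw [List.mem_singleton.1 hx] at hxy
    exact hxy.trans_le (hM y hy)
  have hM' : ∀ x ∈ f :: Q, x ≤ M := by
    intro x hx
    rcases List.mem_cons.1 hx with rfl | hx
    · exact hfM.le
    · exact hM x hx
  have hMQ : M ∈ Q := by rw [hQ]; simp
  have hMlen : M = Q.length := by
    have h1 := hlt M (by simp [hMQ])
    have h2 := hM' _ ((hmem Q.length).2 (by omega))
    omega
  rcases s with _ | ⟨g, s⟩
  · left
    simp only [List.nil_append] at hQ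
    have hsub : List.Sublist (f :: t) (f :: Q) := by
      rw [hQ]; exact (List.sublist_cons_self M t).cons_cons f
    refine ⟨f :: t, ⟨by simp, ⟨hp.std.1.sublist hsub, ?_⟩, hp.avoids.sublist hsub, ?_⟩, ?_⟩
    · intro x hx
      have h1 := hlt x (hsub.subset hx)
      have h2 : x ≠ M := by
        rintro rfl
        rcases List.mem_cons.1 hx with h | h
        · omega
        · rw [hQ] at hnd
          exact (List.nodup_cons.1 hnd.2).1 h
      have h3 : Q.length = t.length + 1 := by rw [hQ]; simp
      simp only [List.length_cons]
      omega
    · intro u v huv hu hv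
      obtain ⟨a, u, rfl⟩ := List.exists_cons_of_ne_nil hu
      simp only [List.cons_append, List.cons.injEq] at huv
      obtain ⟨rfl, rfl⟩ := huv
      obtain ⟨x, hx, y, hy, hxy⟩ := hp.indec (f :: M :: u) v (by simp [hQ]) (by simp) hv
      refine ⟨x, ?_, y, hy, hxy⟩
      simp only [List.mem_cons] at hx ⊢
      have h1 := hM y (by rw [hQ]; simp [hy])
      rcases hx with rfl | rfl | hx
      · simp
      · omega
      · simp [hx]
    · simp only [insertMax, List.headI_cons, List.tail_cons, List.length_cons]
      rw [hQ, hMlen]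
      simp [hQ]
  · right
    have hgf : ∀ x ∈ g :: s, x < f := hp.lt_head f (g :: s) M t (by rw [hQ]) hM'
    set c : ℕ → ℕ := fun v => if v < f then v else v - 1 with hc
    have hQf : ∀ x ∈ Q, x ≠ f := fun x hx h => hnd.1 (h ▸ hx)
    have hcmono : ∀ x ∈ Q, ∀ y ∈ Q, x < y → c x < c y := by
      intro x hx y hy hxy
      have h1 := hQf x hx
      have h2 := hQf y hy
      simp only [hc]
      split_ifs <;> omega
    have hblock : IsBlock (Q.map c) := by
      refine ⟨by simpa, ⟨hnd.2.map_of_lt hcmono, ?_⟩,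
        (hp.avoids.sublist (List.sublist_cons_self f Q)).map hcmono, ?_⟩
      · intro x hx
        obtain ⟨y, hy, rfl⟩ := List.mem_map.1 hx
        have h1 := hlt y (by simp [hy])
        have h2 := hQf y hy
        simp only [List.length_map, hc]
        split_ifs <;> omega
      · refine SkewIndecomposable.map ?_ hcmono
        intro u v huv hu hv
        obtain ⟨x, hx, y, hy, hxy⟩ := hp.indec (f :: u) v (by simp [huv]) (by simp) hv
        rcases List.mem_cons.1 hx with rfl | hx
        · refine ⟨g, ?_, y, hy, (hgf g (by simp)).trans hxy⟩
          obtain ⟨a, u, rfl⟩ := List.exists_cons_of_ne_nil hu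
          rw [huv] at hQ
          simp only [List.cons_append, List.cons.injEq] at hQ
          simp [hQ.1]
        · exact ⟨x, hx, y, hy, hxy⟩
    have hQlen : Q.length = s.length + t.length + 2 := by rw [hQ]; simp; omega
    obtain ⟨A, q, hA, hq, hAq, hlen, -, s', M', t', hMax, hMax'⟩ :=
      hblock.exists_inflate (by simp; omega)
    rw [List.length_map] at hlen
    have hAlt : ∀ x ∈ A, x + q.headI < f := by
      intro x hx
      rw [List.append_assoc] at hMax
      obtain ⟨A', u, hQA, hA', hu⟩ := List.map_eq_append_iff.1 hMax
      obtain ⟨s'', u', rfl, hs'', hu'⟩ := List.map_eq_append_iff.1 hu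
      obtain ⟨m, t'', rfl, rfl, rfl⟩ := List.map_eq_cons_iff.1 hu'
      have hmQ : m ∈ Q := by rw [hQA]; simp
      have hmM : m = M := by
        refine le_antisymm (hM m hmQ) (not_lt.1 fun h => ?_)
        have h1 := hcmono m hmQ M hMQ h
        have h2 := hMax' (c M) (List.mem_map_of_mem hMQ)
        omega
      subst hmM
      obtain ⟨y, hy, hyx⟩ : ∃ y ∈ A', c y = x + q.headI :=
        List.mem_map.1 (hA' ▸ List.mem_map_of_mem hx)
      have hlt' := hp.lt_head f (A' ++ s'') m t'' (by rw [hQA]; simp) hM' y (by simp [hy])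
      simp only [hc, hlt', if_true] at hyx
      omega
    have hApos : 0 < A.length := List.length_pos_iff.2 hA.ne_nil
    have hlast := hAlt (A.length - 1) (hA.std.mem_iff.2 (by omega))
    have hf := hlt f (by simp)
    refine ⟨A, q, hA, hq, ?_, ?_, ?_⟩
    · rw [← hAq, prependWith]
      simp only [List.length_cons, List.length_map, List.headI_cons, List.map_map]
      have h1 : Q.length - (Q.length + 1 - 1 - f) = f := by omega
      rw [h1]
      congr 1
      conv_lhs => rw [← List.map_id Q]
      refine List.map_congr_left fun x hx => ?_
      have := hQf x hx
      simp only [Function.comp, id, hc]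
      split_ifs <;> omega
    · simp only [List.length_cons]; omega
    · simp only [List.length_cons, List.headI_cons]; omega

/-- Every nonempty 1342-avoiding permutation is the skew sum of a block and a 1342-avoiding
permutation. -/
theorem IsStandard.exists_skewSum {p : List ℕ} (hp : IsStandard p) (hav : AvoidsList p)
    (hne : p ≠ []) : ∃ A r, IsBlock A ∧ IsStandard r ∧ AvoidsList r ∧
      p = A.map (· + r.length) ++ r := by
  obtain ⟨S, r, rfl, hS, hSind, hSr⟩ := exists_skewIndecomposable_prefix hne
  have hnd := List.nodup_append.1 hp.1
  have hlt : ∀ x ∈ S, ∀ y ∈ r, y < x := fun x hx y hy =>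
    lt_of_le_of_ne (not_lt.1 (hSr x hx y hy)) (hnd.2.2 x hx y hy).symm
  have hr : IsStandard r := by
    refine ⟨hnd.2.1, fun y hy => ?_⟩
    have h1 : S.toFinset ⊆ Ico (y + 1) (S ++ r).length := by
      intro x hx
      rw [List.mem_toFinset] at hx
      exact mem_Ico.2 ⟨hlt x hx y hy, hp.2 x (by simp [hx])⟩
    have h2 := card_le_card h1
    rw [List.toFinset_card_of_nodup hnd.1, Nat.card_Ico, List.length_append] at h2
    have := List.length_pos_iff.2 hS
    omega
  have hge : ∀ x ∈ S, r.length ≤ x := by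
    intro x hx
    by_contra! h
    exact lt_irrefl x (hlt x hx x (hr.mem_iff.2 h))
  have hmono : ∀ x ∈ S, ∀ y ∈ S, x < y → x - r.length < y - r.length := by
    intro x hx y hy hxy
    have := hge x hx
    omega
  refine ⟨S.map (· - r.length), r, ⟨by simpa using hS, ⟨hnd.1.map_of_lt hmono, ?_⟩,
    (hav.sublist (List.sublist_append_left S r)).map hmono, hSind.map hmono⟩, hr,
    hav.sublist (List.sublist_append_right S r), ?_⟩
  · intro x hx
    obtain ⟨y, hy, rfl⟩ := List.mem_map.1 hx
    have h1 := hp.2 y (by simp [hy])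
    have h2 := hge y hy
    rw [List.length_append] at h1
    rw [List.length_map]
    omega
  · rw [List.map_map]
    congr 1
    conv_lhs => rw [← List.map_id S]
    refine List.map_congr_left fun x hx => ?_
    have := hge x hx
    simp only [Function.comp, id]
    omega

/-- All standard words of length at most `N`. -/
def standardLists (N : ℕ) : Finset (List ℕ) :=
  (range (N + 1)).biUnion fun n => (List.range n).permutations.toFinset

theorem mem_standardLists {N : ℕ} {l : List ℕ} :
    l ∈ standardLists N ↔ IsStandard l ∧ l.length ≤ N := by
  simp only [standardLists, mem_biUnion, mem_range, List.mem_toFinset, List.mem_permutations]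
  constructor
  · rintro ⟨n, hn, h⟩
    have hlen : l.length = n := by simpa using h.length_eq
    refine ⟨⟨h.nodup_iff.2 List.nodup_range, fun x hx => ?_⟩, by omega⟩
    rw [hlen]
    exact List.mem_range.1 (h.subset hx)
  · rintro ⟨h, hlen⟩
    refine ⟨l.length, by omega, ?_⟩
    rw [List.perm_ext_iff_of_nodup h.1 List.nodup_range]
    exact fun x => h.mem_iff.trans List.mem_range.symm

open Classical in
/-- Blocks of length at most `N` with `j` entries above the first one. -/
noncomputable def blocks (N j : ℕ) : Finset (List ℕ) :=
  (standardLists N).filter fun l => IsBlock l ∧ l.length = l.headI + j + 1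

open Classical in
/-- Pointed blocks of length at most `N + 1` with `j` entries above the first one. -/
noncomputable def pointedBlocks (N j : ℕ) : Finset (List ℕ) :=
  (standardLists (N + 1)).filter fun l => IsPointed l ∧ l.length = l.headI + j + 1

open Classical in
/-- 1342-avoiding standard words of length at most `N`. -/
noncomputable def avoidLists (N : ℕ) : Finset (List ℕ) :=
  (standardLists N).filter AvoidsList

theorem mem_blocks {N j : ℕ} {l : List ℕ} :
    l ∈ blocks N j ↔ IsBlock l ∧ l.length ≤ N ∧ l.length = l.headI + j + 1 := by
  simp only [blocks, mem_filter, mem_standardLists]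
  exact ⟨fun h => ⟨h.2.1, h.1.2, h.2.2⟩, fun h => ⟨⟨h.1.std, h.2.1⟩, h.1, h.2.2⟩⟩

theorem mem_pointedBlocks {N j : ℕ} {l : List ℕ} :
    l ∈ pointedBlocks N j ↔ IsPointed l ∧ l.length ≤ N + 1 ∧ l.length = l.headI + j + 1 := by
  simp only [pointedBlocks, mem_filter, mem_standardLists]
  exact ⟨fun h => ⟨h.2.1, h.1.2, h.2.2⟩, fun h => ⟨⟨h.1.std, h.2.1⟩, h.1, h.2.2⟩⟩

theorem mem_avoidLists {N : ℕ} {l : List ℕ} :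
    l ∈ avoidLists N ↔ IsStandard l ∧ AvoidsList l ∧ l.length ≤ N := by
  simp only [avoidLists, mem_filter, mem_standardLists]
  tauto

theorem Finset.sum_le_sum_of_forall_exists {α β : Type*} {s : Finset β} {t : Finset α} (g : α → β)
    {w : β → ℝ} {v : α → ℝ} (hv : ∀ x ∈ t, 0 ≤ v x)
    (h : ∀ y ∈ s, ∃ x ∈ t, g x = y ∧ w y = v x) : ∑ y ∈ s, w y ≤ ∑ x ∈ t, v x := by
  classical
  choose i hit hig hw using h
  have hinj : Set.InjOn (fun y : s => i y y.2) s.attach := fun x _ y _ hxy =>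
    Subtype.ext (by rw [← hig x x.2, ← hig y y.2]; exact congrArg g hxy)
  calc ∑ y ∈ s, w y = ∑ y : s, v (i y y.2) := by
        rw [← Finset.sum_attach]
        exact Finset.sum_congr rfl fun (y : s) _ => hw y y.2
    _ = ∑ x ∈ s.attach.image fun y : s => i y y.2, v x := (Finset.sum_image hinj).symm
    _ ≤ ∑ x ∈ t, v x := Finset.sum_le_sum_of_subset_of_nonneg
        (Finset.image_subset_iff.2 fun (y : s) _ => hit y y.2) fun x hx _ => hv x hx

theorem IsBlock.headI_lt {l : List ℕ} (h : IsBlock l) : l.headI < l.length := by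
  obtain ⟨f, t, rfl⟩ := List.exists_cons_of_ne_nil h.ne_nil
  exact h.std.2 f (by simp)

theorem IsBlock.length_pos {l : List ℕ} (h : IsBlock l) : 0 < l.length :=
  List.length_pos_iff.2 h.ne_nil

theorem IsPointed.headI_add_one_lt {l : List ℕ} (h : IsPointed l) : l.headI + 1 < l.length := by
  obtain ⟨f, t, rfl⟩ := List.exists_cons_of_ne_nil h.ne_nil
  have ht : t ≠ [] := by
    rintro rfl
    simpa using h.two_le
  obtain ⟨x, hx, y, hy, hxy⟩ := h.indec [f] t rfl (by simp) ht
  rw [List.mem_singleton.1 hx] at hxy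
  have := h.std.2 y (by simp [hy])
  simp only [List.headI_cons]
  omega

/-- The total weight of `blocks N j` at `x = 1 / 8`. -/
noncomputable def blockWeight (N j : ℕ) : ℝ := ∑ l ∈ blocks N j, (1 / 8 : ℝ) ^ l.length

/-- The total weight of `pointedBlocks N j` at `x = 1 / 8`, not counting the first entry. -/
noncomputable def pointedWeight (N j : ℕ) : ℝ :=
  ∑ l ∈ pointedBlocks N j, (1 / 8 : ℝ) ^ (l.length - 1)

theorem pointedWeight_nonneg (N j : ℕ) : 0 ≤ pointedWeight N j :=
  Finset.sum_nonneg fun _ _ => by positivity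

theorem blockWeight_zero_right (N : ℕ) : blockWeight N 0 ≤ 1 / 8 := by
  have h : blocks N 0 ⊆ {[0]} := by
    intro p hp
    obtain ⟨hb, -, hj⟩ := mem_blocks.1 hp
    have h1 : p.length < 2 := by
      by_contra! h2
      obtain ⟨A, q, hA, hq, -, hlen, hhead, -⟩ := hb.exists_inflate h2
      have := hA.headI_lt
      have := hq.headI_add_one_lt
      omega
    obtain ⟨x, rfl⟩ := List.length_eq_one_iff.1 (by have := hb.length_pos; omega : p.length = 1)
    have := hb.std.2 x (by simp)
    simp only [List.length_singleton, Nat.lt_one_iff] at this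
    simp [this]
  calc blockWeight N 0 ≤ ∑ l ∈ {[0]}, (1 / 8 : ℝ) ^ l.length :=
        Finset.sum_le_sum_of_subset_of_nonneg h fun _ _ _ => by positivity
    _ = 1 / 8 := by simp

theorem blockWeight_succ_succ_le (N m : ℕ) : blockWeight (N + 1) (m + 1) ≤
    ∑ ij ∈ antidiagonal m, blockWeight N ij.1 * pointedWeight N (ij.2 + 1) := by
  simp only [blockWeight, pointedWeight, Finset.sum_mul_sum, ← Finset.sum_product']
  rw [Finset.sum_sigma']
  refine Finset.sum_le_sum_of_forall_exists (fun x => inflate x.2.1 x.2.2)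
    (fun _ _ => by positivity) fun p hp => ?_
  obtain ⟨hb, hN, hj⟩ := mem_blocks.1 hp
  obtain ⟨A, q, hA, hq, rfl, hlen, hhead, -⟩ := hb.exists_inflate (by omega)
  have h1 := hA.headI_lt
  have h2 := hq.headI_add_one_lt
  refine ⟨⟨(A.length - 1 - A.headI, q.length - 2 - q.headI), (A, q)⟩, ?_, rfl, ?_⟩
  · simp only [mem_sigma, HasAntidiagonal.mem_antidiagonal, mem_product, mem_blocks,
      mem_pointedBlocks]
    exact ⟨by omega, ⟨hA, by omega, by omega⟩, hq, by omega, by omega⟩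
  · dsimp only
    rw [← pow_add]
    congr 1
    omega

theorem pointedWeight_succ_succ_le (N h : ℕ) : pointedWeight (N + 1) (h + 1) ≤
    blockWeight (N + 1) h +
      (∑ j ∈ range N, blockWeight N j) * ∑ k ∈ range N, pointedWeight N (h + k + 1) := by
  classical
  rw [pointedWeight, ← Finset.sum_filter_add_sum_filter_not _
    (fun p => ∃ r, IsBlock r ∧ p = insertMax r)]
  refine add_le_add ?_ ?_
  · refine Finset.sum_le_sum_of_forall_exists insertMax (fun _ _ => by positivity) fun p hp => ?_
    obtain ⟨hp, r, hr, rfl⟩ := mem_filter.1 hp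
    obtain ⟨-, hN, hj⟩ := mem_pointedBlocks.1 hp
    have h1 := hr.length_pos
    simp only [insertMax, List.length_cons, List.length_tail, List.headI_cons] at hN hj ⊢
    refine ⟨r, mem_blocks.2 ⟨hr, by omega, by omega⟩, rfl, ?_⟩
    congr 1
    omega
  · rw [Finset.sum_mul_sum, ← Finset.sum_product']
    simp only [blockWeight, pointedWeight, Finset.sum_mul_sum, ← Finset.sum_product']
    rw [Finset.sum_sigma']
    refine Finset.sum_le_sum_of_forall_exists
      (fun x => prependWith (h + 1) (inflate x.2.1 x.2.2))
      (fun _ _ => by positivity) fun p hp => ?_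
    obtain ⟨hp, hnot⟩ := mem_filter.1 hp
    obtain ⟨hpt, hN, hj⟩ := mem_pointedBlocks.1 hp
    obtain ⟨A, q, hA, hq, heq, hlen, hle⟩ := hpt.exists_insertMax_or_prependWith.resolve_left hnot
    have h1 := hA.headI_lt
    have h2 := hq.headI_add_one_lt
    have h3 : p.length - 1 - p.headI = h + 1 := by omega
    rw [h3] at heq hle
    refine ⟨⟨(A.length - 1 - A.headI, q.length - 1 - q.headI - (h + 1)), (A, q)⟩, ?_, heq.symm, ?_⟩
    · simp only [mem_sigma, mem_range, mem_product, mem_blocks, mem_pointedBlocks]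
      exact ⟨⟨by omega, by omega⟩, ⟨hA, by omega, by omega⟩, hq, by omega, by omega⟩
    · dsimp only
      rw [← pow_add]
      congr 1
      omega

theorem sum_blockWeight_le (N n : ℕ) : ∑ j ∈ range n, blockWeight N j ≤ 5 / 32 := by
  obtain ⟨a, b, ha, hb, ha0, harec, htail, hsum⟩ := exists_solution
  suffices h : (∀ j, blockWeight N j ≤ a j) ∧ ∀ j, pointedWeight N (j + 1) ≤ a j + b j from
    (Finset.sum_le_sum fun j _ => h.1 j).trans (hsum n)
  induction N with
  | zero =>
    constructor
    · intro j
      rw [blockWeight, Finset.sum_eq_zero]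
      · exact ha j
      · intro l hl
        obtain ⟨-, h1, h2⟩ := mem_blocks.1 hl
        omega
    · intro j
      rw [pointedWeight, Finset.sum_eq_zero]
      · exact add_nonneg (ha j) (hb j)
      · intro l hl
        obtain ⟨-, h1, h2⟩ := mem_pointedBlocks.1 hl
        omega
  | succ N ih =>
    have hB : ∀ j, blockWeight (N + 1) j ≤ a j := by
      intro j
      rcases j with _ | m
      · exact (blockWeight_zero_right _).trans ha0.ge
      · rw [harec]
        refine (blockWeight_succ_succ_le N m).trans (Finset.sum_le_sum fun ij _ => ?_)
        exact mul_le_mul (ih.1 _) (ih.2 _) (pointedWeight_nonneg _ _) (ha _)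
    refine ⟨hB, fun j => (pointedWeight_succ_succ_le N j).trans (add_le_add (hB j) ?_)⟩
    have h1 : ∑ i ∈ range N, blockWeight N i ≤ 5 / 32 :=
      (Finset.sum_le_sum fun j _ => ih.1 j).trans (hsum N)
    have h2 : 5 / 32 * ∑ k ∈ range N, (a (j + k) + b (j + k)) = b j - b (j + N) := by
      rw [Finset.mul_sum, show b j - b (j + N) = b (j + 0) - b (j + N) by simp,
        ← Finset.sum_range_sub' fun k => b (j + k)]
      exact Finset.sum_congr rfl fun k _ => (htail (j + k)).symm
    calc _ ≤ 5 / 32 * ∑ k ∈ range N, (a (j + k) + b (j + k)) :=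
          mul_le_mul h1 (Finset.sum_le_sum fun k _ => ih.2 _)
            (Finset.sum_nonneg fun _ _ => pointedWeight_nonneg _ _) (by norm_num)
      _ ≤ b j := by rw [h2]; linarith [hb (j + N)]

theorem sum_avoidLists_le (N : ℕ) : ∑ l ∈ avoidLists N, (1 / 8 : ℝ) ^ l.length ≤ 32 / 27 := by
  classical
  have hstep : ∀ M, ∑ l ∈ (avoidLists M).filter (· ≠ []), (1 / 8 : ℝ) ^ l.length ≤
      5 / 32 * ∑ l ∈ avoidLists (M - 1), (1 / 8 : ℝ) ^ l.length := by
    intro M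
    refine le_trans ?_ (mul_le_mul_of_nonneg_right (sum_blockWeight_le M M)
      (Finset.sum_nonneg fun _ _ => by positivity))
    simp only [blockWeight]
    rw [Finset.sum_sigma', Finset.sum_mul_sum, ← Finset.sum_product']
    refine Finset.sum_le_sum_of_forall_exists
      (fun x => x.1.2.map (· + x.2.length) ++ x.2) (fun _ _ => by positivity) fun p hp => ?_
    obtain ⟨hp, hne⟩ := mem_filter.1 hp
    obtain ⟨hstd, hav, hM⟩ := mem_avoidLists.1 hp
    obtain ⟨A, r, hA, hr, hrav, rfl⟩ := hstd.exists_skewSum hav hne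
    have h1 := hA.headI_lt
    simp only [List.length_append, List.length_map] at hM
    refine ⟨(⟨A.length - 1 - A.headI, A⟩, r), ?_, rfl, ?_⟩
    · simp only [mem_product, mem_sigma, mem_range, mem_blocks, mem_avoidLists]
      exact ⟨⟨by omega, hA, by omega, by omega⟩, hr, hrav, by omega⟩
    · rw [← pow_add]
      simp
  have hsplit : ∀ M, ∑ l ∈ avoidLists M, (1 / 8 : ℝ) ^ l.length =
      1 + ∑ l ∈ (avoidLists M).filter (· ≠ []), (1 / 8 : ℝ) ^ l.length := by
    intro M
    have h : (avoidLists M).filter (· ≠ []) = (avoidLists M).erase [] := by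
      ext; simp [and_comm]
    have hmem : [] ∈ avoidLists M :=
      mem_avoidLists.2 ⟨⟨by simp, by simp⟩, fun a b c d h => by simp at h, by simp⟩
    rw [h, ← Finset.add_sum_erase _ _ hmem]
    simp
  induction N with
  | zero =>
    rw [hsplit, Finset.sum_eq_zero]
    · norm_num
    · intro l hl
      obtain ⟨hl, hne⟩ := mem_filter.1 hl
      have := (mem_avoidLists.1 hl).2.2
      exact absurd (List.length_eq_zero_iff.1 (by omega)) hne
  | succ N ih =>
    rw [hsplit]
    have := hstep (N + 1)
    rw [Nat.add_sub_cancel] at this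
    linarith

open Classical in
theorem card_avoidLists_length_eq_le (n : ℕ) :
    (((avoidLists n).filter fun l => l.length = n).card : ℝ) ≤ 8 ^ n := by
  rcases Nat.eq_zero_or_pos n with rfl | hn
  · have : (avoidLists 0).filter (fun l => l.length = 0) ⊆ {[]} := by
      intro l hl
      simpa using (mem_filter.1 hl).2
    exact_mod_cast (card_le_card this).trans (by simp)
  · have hmem : [] ∈ avoidLists n :=
      mem_avoidLists.2 ⟨⟨by simp, by simp⟩, fun a b c d h => by simp at h, by simp⟩
    have hsub : insert [] ((avoidLists n).filter fun l => l.length = n) ⊆ avoidLists n :=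
      Finset.insert_subset hmem (Finset.filter_subset _ _)
    have h := (Finset.sum_le_sum_of_subset_of_nonneg (f := fun l => (1 / 8 : ℝ) ^ l.length) hsub
      fun _ _ _ => by positivity).trans (sum_avoidLists_le n)
    rw [Finset.sum_insert (by simp; omega), Finset.sum_congr rfl
      (g := fun _ => (1 / 8 : ℝ) ^ n) (fun l hl => by rw [(mem_filter.1 hl).2])] at h
    rw [Finset.sum_const, nsmul_eq_mul, List.length_nil, pow_zero, one_div_pow, mul_one_div] at h
    rw [← div_le_one (by positivity : (0 : ℝ) < 8 ^ n)]
    linarith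

/-- The positions of the left-to-right minima of `σ`. -/
def lrMinima {n : ℕ} (σ : Equiv.Perm (Fin n)) : Finset (Fin n) :=
  univ.filter fun i => ∀ j < i, σ i < σ j

/-- The values of the left-to-right minima of `σ`. -/
def lrMinimaValues {n : ℕ} (σ : Equiv.Perm (Fin n)) : Finset (Fin n) :=
  (lrMinima σ).map σ.toEmbedding

/-- The number of elements of `W` below `x`. -/
def rankIn {n : ℕ} (W : Finset (Fin n)) (x : Fin n) : ℕ := (W.filter (· < x)).card

/-- The word obtained from `σ` by deleting the left-to-right minima and standardizing. -/
def restWord {n : ℕ} (σ : Equiv.Perm (Fin n)) : List ℕ :=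
  ((lrMinima σ)ᶜ.sort (· ≤ ·)).map fun i => rankIn (lrMinimaValues σ)ᶜ (σ i)

section

variable {n : ℕ}

theorem rankIn_lt_rankIn {W : Finset (Fin n)} {x y : Fin n} (hx : x ∈ W) (h : x < y) :
    rankIn W x < rankIn W y :=
  card_lt_card <| Finset.ssubset_iff_of_subset
    (fun _ hz => mem_filter.2 ⟨(mem_filter.1 hz).1, (mem_filter.1 hz).2.trans h⟩) |>.2
    ⟨x, mem_filter.2 ⟨hx, h⟩, fun hx' => lt_irrefl _ (mem_filter.1 hx').2⟩

theorem rankIn_lt_iff {W : Finset (Fin n)} {x y : Fin n} (hx : x ∈ W) (hy : y ∈ W) :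
    rankIn W x < rankIn W y ↔ x < y := by
  refine ⟨fun h => ?_, rankIn_lt_rankIn hx⟩
  by_contra! hyx
  rcases hyx.eq_or_lt with rfl | hlt
  · exact lt_irrefl _ h
  · exact lt_asymm h (rankIn_lt_rankIn hy hlt)

theorem rankIn_injOn (W : Finset (Fin n)) : Set.InjOn (rankIn W) W := by
  intro x hx y hy hxy
  have h1 := rankIn_lt_iff hx hy
  have h2 := rankIn_lt_iff hy hx
  rw [hxy] at h1 h2
  exact le_antisymm (not_lt.1 fun h => lt_irrefl _ (h2.2 h)) (not_lt.1 fun h => lt_irrefl _ (h1.2 h))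

theorem rankIn_lt_card {W : Finset (Fin n)} {x : Fin n} (hx : x ∈ W) : rankIn W x < W.card :=
  card_lt_card <| Finset.filter_ssubset.2 ⟨x, hx, lt_irrefl _⟩

theorem mem_lrMinima {σ : Equiv.Perm (Fin n)} {i : Fin n} :
    i ∈ lrMinima σ ↔ ∀ j < i, σ i < σ j := by
  simp [lrMinima]

theorem apply_mem_lrMinimaValues_iff {σ : Equiv.Perm (Fin n)} {i : Fin n} :
    σ i ∈ lrMinimaValues σ ↔ i ∈ lrMinima σ := by
  simp [lrMinimaValues]

theorem card_lrMinimaValues (σ : Equiv.Perm (Fin n)) :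
    (lrMinimaValues σ).card = (lrMinima σ).card :=
  card_map _

theorem length_restWord (σ : Equiv.Perm (Fin n)) :
    (restWord σ).length = n - (lrMinima σ).card := by
  simp [restWord, card_compl]

theorem isStandard_restWord (σ : Equiv.Perm (Fin n)) : IsStandard (restWord σ) := by
  have hmem : ∀ i ∈ (lrMinima σ)ᶜ.sort (· ≤ ·), σ i ∈ (lrMinimaValues σ)ᶜ := by
    intro i hi
    rw [mem_compl, apply_mem_lrMinimaValues_iff, ← mem_compl]
    exact (mem_sort _).1 hi
  constructor
  · exact (sort_nodup _ _).map_on fun i hi j hj h =>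
      σ.injective (rankIn_injOn _ (hmem i hi) (hmem j hj) h)
  · intro x hx
    obtain ⟨i, hi, rfl⟩ := List.mem_map.1 hx
    refine (rankIn_lt_card (hmem i hi)).trans_eq ?_
    rw [length_restWord, card_compl, card_lrMinimaValues, Fintype.card_fin]

theorem PermAvoids.avoidsList_restWord {σ : Equiv.Perm (Fin n)} (h : PermAvoids σ pat12453) :
    AvoidsList (restWord σ) := by
  intro a b c d hsub had hdb hbc
  obtain ⟨l, hl, heq⟩ := List.sublist_map_iff.1 hsub
  obtain ⟨i₁, i₂, i₃, i₄, rfl⟩ : ∃ i₁ i₂ i₃ i₄, l = [i₁, i₂, i₃, i₄] :=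
    List.length_eq_four.1 (by simpa using (congrArg List.length heq).symm)
  simp only [List.map_cons, List.map_nil, List.cons.injEq, and_true] at heq
  obtain ⟨rfl, rfl, rfl, rfl⟩ := heq
  have hP : ∀ i ∈ [i₁, i₂, i₃, i₄], i ∉ lrMinima σ := fun i hi =>
    mem_compl.1 ((mem_sort _).1 (hl.subset hi))
  have hV : ∀ i ∈ [i₁, i₂, i₃, i₄], σ i ∈ (lrMinimaValues σ)ᶜ := fun i hi => by
    rw [mem_compl, apply_mem_lrMinimaValues_iff]
    exact hP i hi
  rw [rankIn_lt_iff (hV _ (by simp)) (hV _ (by simp))] at had hdb hbc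
  have hsorted := (sortedLT_sort (lrMinima σ)ᶜ).pairwise.sublist hl
  simp only [List.pairwise_cons, List.mem_cons, List.not_mem_nil, or_false, forall_eq_or_imp,
    forall_eq] at hsorted
  obtain ⟨j, hj, hjσ⟩ : ∃ j < i₁, σ j < σ i₁ := by
    have := hP i₁ (by simp)
    rw [mem_lrMinima] at this
    push Not at this
    obtain ⟨j, hj, hle⟩ := this
    exact ⟨j, hj, hle.lt_of_ne fun he => hj.ne (σ.injective he)⟩
  refine h ⟨![j, i₁, i₂, i₃, i₄], ?_, ?_⟩
  · rw [Fin.strictMono_iff_lt_succ]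
    intro k
    fin_cases k
    exacts [hj, hsorted.1.1, hsorted.2.1.1, hsorted.2.2.1]
  · have hval : StrictMono ![σ j, σ i₁, σ i₄, σ i₂, σ i₃] := by
      rw [Fin.strictMono_iff_lt_succ]
      intro k
      fin_cases k
      exacts [hjσ, had, hdb, hbc]
    have hcomp : ∀ k, σ (![j, i₁, i₂, i₃, i₄] k) =
        ![σ j, σ i₁, σ i₄, σ i₂, σ i₃] (pat12453 k) := by
      intro k
      fin_cases k <;> rfl
    intro k k'
    rw [hcomp, hcomp]
    exact hval.lt_iff_lt

theorem eq_of_lrMinima_eq_of_restWord_eq {σ τ : Equiv.Perm (Fin n)}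
    (hP : lrMinima σ = lrMinima τ) (hV : lrMinimaValues σ = lrMinimaValues τ)
    (hw : restWord σ = restWord τ) : σ = τ := by
  have key : ∀ σ τ : Equiv.Perm (Fin n), lrMinima σ = lrMinima τ →
      lrMinimaValues σ = lrMinimaValues τ → ∀ i ∈ lrMinima σ,
      (∀ j < i, j ∈ lrMinima σ → σ j = τ j) → ¬ σ i < τ i := by
    intro σ τ hP hV i hi ih hlt
    have hτ : τ i ∈ lrMinimaValues σ := by
      rwa [hV, apply_mem_lrMinimaValues_iff, ← hP]
    obtain ⟨k, hk, hki⟩ := mem_map.1 hτ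
    change σ k = τ i at hki
    rw [← hki] at hlt
    have hlt' : k < i := by
      by_contra! hik
      rcases hik.eq_or_lt with rfl | hik
      · exact lt_irrefl _ hlt
      · exact lt_asymm hlt (mem_lrMinima.1 hk i hik)
    rw [ih k hlt' hk] at hki
    exact hlt'.ne (τ.injective hki)
  have hmin : ∀ i, i ∈ lrMinima σ → σ i = τ i := by
    intro i
    induction i using WellFoundedLT.induction with
    | ind i ih =>
      intro hi
      exact le_antisymm
        (not_lt.1 (key τ σ hP.symm hV.symm i (hP ▸ hi) fun j hj hjP => (ih j hj (hP ▸ hjP)).symm))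
        (not_lt.1 (key σ τ hP hV i hi ih))
  ext1 i
  by_cases hi : i ∈ lrMinima σ
  · exact hmin i hi
  · rw [restWord, restWord, hP, hV, List.map_inj_left] at hw
    refine rankIn_injOn _ ?_ ?_ (hw i ((mem_sort _).2 (mem_compl.2 (hP ▸ hi))))
    · rw [mem_coe, mem_compl, ← hV, apply_mem_lrMinimaValues_iff]
      exact hi
    · rw [mem_coe, mem_compl, apply_mem_lrMinimaValues_iff, ← hP]
      exact hi

open Classical in
theorem avoiders_le_sum (n : ℕ) : (avoiders n pat12453 : ℝ) ≤
    ∑ PV : Finset (Fin n) × Finset (Fin n),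
      if PV.1.card = PV.2.card then (8 : ℝ) ^ (n - PV.1.card) else 0 := by
  let words (PV : Finset (Fin n) × Finset (Fin n)) : Finset (List ℕ) :=
    if PV.1.card = PV.2.card then
      (avoidLists (n - PV.1.card)).filter fun l => l.length = n - PV.1.card else ∅
  have hcard : avoiders n pat12453 ≤ (univ.sigma words).card := by
    rw [avoiders, Nat.card_eq_fintype_card, Fintype.card_subtype]
    refine card_le_card_of_injOn (fun σ => ⟨(lrMinima σ, lrMinimaValues σ), restWord σ⟩) ?_ ?_
    · intro σ hσ
      have hσ : PermAvoids σ pat12453 := by simpa using hσ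
      simp only [coe_sigma, Set.mem_sigma_iff, words, card_lrMinimaValues, if_true, mem_coe,
        mem_univ, true_and, mem_filter, mem_avoidLists, length_restWord, le_refl, and_true]
      exact ⟨isStandard_restWord σ, hσ.avoidsList_restWord⟩
    · intro σ _ τ _ h
      simp only [Sigma.mk.injEq, Prod.mk.injEq, heq_eq_eq] at h
      exact eq_of_lrMinima_eq_of_restWord_eq h.1.1 h.1.2 h.2
  calc (avoiders n pat12453 : ℝ) ≤ ((univ.sigma words).card : ℝ) := by exact_mod_cast hcard
    _ = ∑ PV, ((words PV).card : ℝ) := by rw [card_sigma, Nat.cast_sum]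
    _ ≤ _ := by
      refine Finset.sum_le_sum fun PV _ => ?_
      simp only [words]
      split_ifs
      · exact card_avoidLists_length_eq_le _
      · simp

end

/-- For all positive integers `n`, `S_n(12453) < (9 + 4√2)^n`. -/
theorem stanley_wilf_12453_upper (n : ℕ) (hn : 0 < n) :
    (avoiders n pat12453 : ℝ) < (9 + 4 * Real.sqrt 2) ^ n := by
  have h2 : Real.sqrt 2 ^ 2 = 2 := Real.sq_sqrt (by norm_num)
  obtain ⟨r, hr⟩ : ∃ r, r = 2 * Real.sqrt 2 := ⟨_, rfl⟩
  have hr0 : 0 < r := by rw [hr]; positivity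
  have hr2 : r * r = 8 := by rw [hr]; linear_combination 4 * h2
  have hsum : ∑ P : Finset (Fin n), r ^ (n - P.card) = (1 + r) ^ n := by
    simpa using Fintype.sum_pow_mul_eq_add_pow (Fin n) (1 : ℝ) r
  calc (avoiders n pat12453 : ℝ) ≤ _ := avoiders_le_sum n
    _ < ∑ PV : Finset (Fin n) × Finset (Fin n), r ^ (n - PV.1.card) * r ^ (n - PV.2.card) := by
      refine Finset.sum_lt_sum (fun PV _ => ?_) ⟨(∅, univ), mem_univ _, ?_⟩
      · split_ifs with h
        · rw [← h, ← mul_pow, hr2]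
        · positivity
      · rw [if_neg (by simpa using hn.ne)]
        positivity
    _ = ((1 + r) * (1 + r)) ^ n := by
      rw [mul_pow, ← hsum, Finset.sum_mul_sum, ← Finset.univ_product_univ, Finset.sum_product]
    _ = (9 + 4 * Real.sqrt 2) ^ n := by
      congr 1
      rw [show (1 + r) * (1 + r) = 1 + 2 * r + r * r by ring, hr2, hr]
      ring
end

section
/- The limit superior of the sequence (S_n(12453))^{1/n} is at most 9 + 4√2 (and in particular is less than 14.66). -/
section

open Finset

/-- The Catalan generating function evaluated at `3X/16`. -/
noncomputable def scaledCatalan : PowerSeries ℝ :=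
  PowerSeries.mk fun n => (catalan n : ℝ) * (3 / 16) ^ n

theorem scaledCatalan_eq :
    16 * scaledCatalan = 16 + 3 * PowerSeries.X * scaledCatalan ^ 2 := by
  have h : scaledCatalan = 1 + PowerSeries.C (3 / 16) * (PowerSeries.X * scaledCatalan ^ 2) := by
    ext n
    cases n with
    | zero => simp [scaledCatalan]
    | succ n =>
      rw [map_add, PowerSeries.coeff_C_mul, PowerSeries.coeff_succ_X_mul, PowerSeries.coeff_one,
        if_neg (by omega), zero_add, pow_two, PowerSeries.coeff_mul]
      simp only [scaledCatalan, PowerSeries.coeff_mk, catalan_succ']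
      push_cast
      rw [Finset.mul_sum, Finset.sum_mul]
      refine Finset.sum_congr rfl fun x hx => ?_
      rw [← mem_antidiagonal.1 hx]
      ring
  have h16 : (16 : PowerSeries ℝ) * PowerSeries.C (3 / 16) = 3 := by
    rw [← map_ofNat (PowerSeries.C (R := ℝ)) 16, ← map_ofNat (PowerSeries.C (R := ℝ)) 3, ← map_mul]
    norm_num
  linear_combination 16 * h + (PowerSeries.X * scaledCatalan ^ 2) * h16

/-- The weight bounding the contribution of words with top statistic `m`. -/
noncomputable def topWeight (m : ℕ) : ℝ :=
  (4 * catalan m - catalan (m + 1)) / 3 * (3 / 16) ^ m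

theorem catalan_succ_le (m : ℕ) : catalan (m + 1) ≤ 4 * catalan m := by
  have h1 := succ_mul_catalan_eq_centralBinom m
  have h2 := succ_mul_catalan_eq_centralBinom (m + 1)
  have h3 := Nat.succ_mul_centralBinom_succ m
  rw [← h1, ← h2] at h3
  have h4 : (m + 1) * ((m + 2) * catalan (m + 1)) = (m + 1) * (2 * (2 * m + 1) * catalan m) := by
    linarith
  have h5 := Nat.eq_of_mul_eq_mul_left (Nat.succ_pos m) h4
  nlinarith [Nat.zero_le (catalan m), Nat.zero_le (catalan (m + 1))]

theorem topWeight_nonneg (m : ℕ) : 0 ≤ topWeight m := by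
  have h : (catalan (m + 1) : ℝ) ≤ 4 * catalan m := by exact_mod_cast catalan_succ_le m
  unfold topWeight
  have : (0 : ℝ) ≤ (4 * catalan m - catalan (m + 1)) / 3 := by linarith
  positivity

theorem topWeight_zero : topWeight 0 = 1 := by norm_num [topWeight]

theorem sum_antidiagonal_le (f g : ℕ → ℝ) (hf : ∀ n, 0 ≤ f n) (hg : ∀ n, 0 ≤ g n) (N : ℕ) :
    ∑ n ∈ range N, ∑ x ∈ antidiagonal n, f x.1 * g x.2 ≤
      (∑ n ∈ range N, f n) * ∑ n ∈ range N, g n := by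
  have h : ∀ n ∈ range N, antidiagonal n = {x ∈ range N ×ˢ range N | x.1 + x.2 = n} := by
    intro n hn
    ext x
    simp only [HasAntidiagonal.mem_antidiagonal, mem_filter, mem_product, mem_range] at *
    omega
  rw [Finset.sum_mul_sum, ← Finset.sum_product', Finset.sum_congr rfl fun n hn => by rw [h n hn]]
  exact Finset.sum_fiberwise_le_sum_of_sum_fiber_nonneg fun n _ =>
    Finset.sum_nonneg fun x _ => mul_nonneg (hf _) (hg _)

theorem sum_catalan_le {w κ : ℝ} (hw : 0 ≤ w) (hκ : κ = 1 + w * κ ^ 2) (N : ℕ) :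
    ∑ n ∈ range N, (catalan n : ℝ) * w ^ n ≤ κ := by
  have h0 : 0 ≤ κ := by rw [hκ]; positivity
  induction N with
  | zero => simpa using h0
  | succ N ih =>
    rw [Finset.sum_range_succ']
    have h1 : ∑ n ∈ range N, (catalan (n + 1) : ℝ) * w ^ (n + 1) =
        w * ∑ n ∈ range N, ∑ x ∈ antidiagonal n,
          ((catalan x.1 : ℝ) * w ^ x.1) * ((catalan x.2 : ℝ) * w ^ x.2) := by
      rw [Finset.mul_sum]
      refine Finset.sum_congr rfl fun n _ => ?_
      rw [catalan_succ']
      push_cast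
      rw [Finset.mul_sum, Finset.sum_mul]
      refine Finset.sum_congr rfl fun x hx => ?_
      rw [← mem_antidiagonal.1 hx]
      ring
    have h2 := sum_antidiagonal_le (fun n => (catalan n : ℝ) * w ^ n)
      (fun n => (catalan n : ℝ) * w ^ n) (fun n => by positivity) (fun n => by positivity) N
    have h3 : 0 ≤ ∑ n ∈ range N, (catalan n : ℝ) * w ^ n :=
      Finset.sum_nonneg fun n _ => by positivity
    have h4 : (∑ n ∈ range N, (catalan n : ℝ) * w ^ n) * ∑ n ∈ range N, (catalan n : ℝ) * w ^ n
        ≤ κ * κ := mul_le_mul ih ih h3 h0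
    rw [h1]
    have h5 := mul_le_mul_of_nonneg_left (h2.trans h4) hw
    simp only [catalan_zero, pow_zero, Nat.cast_one, mul_one]
    nlinarith

theorem hasSum_catalan {w κ : ℝ} (hw : 0 ≤ w) (hκ : κ = 1 + w * κ ^ 2) (hlt : w * (2 * κ) < 1) :
    HasSum (fun n => (catalan n : ℝ) * w ^ n) κ := by
  have hs : Summable (fun n => (catalan n : ℝ) * w ^ n) :=
    summable_of_sum_range_le (fun n => by positivity) (sum_catalan_le hw hκ)
  have hle : ∑' n, (catalan n : ℝ) * w ^ n ≤ κ :=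
    hs.tsum_le_of_sum_range_le (sum_catalan_le hw hκ)
  have hc : ∑' n, (catalan n : ℝ) * w ^ n = 1 + w * (∑' n, (catalan n : ℝ) * w ^ n) ^ 2 := by
    conv_lhs => rw [hs.tsum_eq_zero_add]
    rw [pow_two, tsum_mul_tsum_eq_tsum_sum_antidiagonal_of_summable_norm hs.norm hs.norm,
      ← tsum_mul_left]
    simp only [catalan_zero, pow_zero, Nat.cast_one, mul_one]
    congr 1
    refine tsum_congr fun n => ?_
    rw [catalan_succ']
    push_cast
    rw [Finset.mul_sum, Finset.sum_mul]
    refine Finset.sum_congr rfl fun x hx => ?_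
    rw [← mem_antidiagonal.1 hx]
    ring
  have hpos : 0 ≤ ∑' n, (catalan n : ℝ) * w ^ n := tsum_nonneg fun n => by positivity
  have heq : ∑' n, (catalan n : ℝ) * w ^ n = κ := by
    set c := ∑' n, (catalan n : ℝ) * w ^ n
    have h : (κ - c) * (1 - w * (κ + c)) = 0 := by linear_combination hκ - hc
    rcases mul_eq_zero.1 h with h | h
    · linarith
    · nlinarith
  rw [← heq]
  exact hs.hasSum

theorem sum_topWeight_mul_pow_le {u κ : ℝ} (hu : 0 < u) (hκ : κ = 1 + 3 / 16 * u * κ ^ 2)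
    (hlt : 3 / 16 * u * (2 * κ) < 1) (N : ℕ) :
    ∑ m ∈ range N, topWeight m * u ^ m ≤ (4 * κ - κ ^ 2) / 3 := by
  have h := hasSum_catalan (w := 3 / 16 * u) (by positivity) hκ hlt
  have h1 := (hasSum_nat_add_iff' 1).2 h
  have h2 : HasSum (fun m => topWeight m * u ^ m)
      ((4 * κ - (κ - 1) / (3 / 16 * u)) / 3) := by
    have := ((h.mul_left 4).sub (h1.div_const (3 / 16 * u))).div_const 3
    simp only [Finset.sum_range_one, catalan_zero, pow_zero, Nat.cast_one, mul_one] at this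
    have e : (fun m => topWeight m * u ^ m) = fun m => (4 * ((catalan m : ℝ) * (3 / 16 * u) ^ m) -
        (catalan (m + 1) : ℝ) * (3 / 16 * u) ^ (m + 1) / (3 / 16 * u)) / 3 := by
      funext m
      simp only [topWeight, pow_succ, mul_pow]
      field_simp
    rw [e]
    exact this
  have h3 : (κ - 1) / (3 / 16 * u) = κ ^ 2 := by
    rw [div_eq_iff (by positivity)]
    linarith
  rw [h3] at h2
  exact sum_le_hasSum _ (fun m _ => mul_nonneg (topWeight_nonneg m) (by positivity)) h2

theorem sum_topWeight_le (N : ℕ) : ∑ m ∈ range N, topWeight m ≤ 32 / 27 := by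
  have := sum_topWeight_mul_pow_le (u := 1) (κ := 4 / 3) (by norm_num) (by norm_num)
    (by norm_num) N
  simp only [one_pow, mul_one] at this
  linarith

/-- The weight bounding the contribution of split words with `c` entries on top. -/
noncomputable def splitWeight (c : ℕ) : ℝ :=
  (5 / 4 - ∑ m ∈ range c, topWeight m * (32 / 27) ^ m) / (32 / 27) ^ c

theorem splitWeight_nonneg (c : ℕ) : 0 ≤ splitWeight c := by
  have := sum_topWeight_mul_pow_le (u := 32 / 27) (κ := 3 / 2) (by norm_num) (by norm_num)
    (by norm_num) c
  unfold splitWeight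
  refine div_nonneg ?_ (by positivity)
  linarith

theorem splitWeight_eq (c : ℕ) :
    splitWeight c = topWeight c + 32 / 27 * splitWeight (c + 1) := by
  unfold splitWeight
  rw [Finset.sum_range_succ, pow_succ]
  field_simp
  ring

theorem topWeight_succ (m : ℕ) :
    topWeight (m + 1) = 1 / 8 * (topWeight m +
      ∑ x ∈ antidiagonal m, (if x.1 = 0 then 0 else topWeight x.1) * splitWeight x.2) := by
  set Φ : PowerSeries ℝ := PowerSeries.mk topWeight with hΦd
  set Ψ : PowerSeries ℝ := PowerSeries.mk splitWeight with hΨd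
  have nat (k : ℕ) [k.AtLeastTwo] (f : PowerSeries ℝ) (m : ℕ) :
      PowerSeries.coeff m (OfNat.ofNat k * f) = OfNat.ofNat k * PowerSeries.coeff m f := by
    rw [← map_ofNat (PowerSeries.C (R := ℝ)) k, PowerSeries.coeff_C_mul]
  have hΦ : 3 * Φ = 4 * scaledCatalan - scaledCatalan ^ 2 := by
    ext m
    have h := congrArg (PowerSeries.coeff (m + 1)) scaledCatalan_eq
    have h16 : PowerSeries.coeff (m + 1) (16 : PowerSeries ℝ) = 0 := by
      rw [← map_ofNat (PowerSeries.C (R := ℝ)) 16, PowerSeries.coeff_C, if_neg (by omega)]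
    rw [map_add, nat, mul_assoc, nat, PowerSeries.coeff_succ_X_mul, h16] at h
    rw [map_sub, nat, nat]
    simp only [hΦd, PowerSeries.coeff_mk, scaledCatalan, topWeight] at *
    rw [pow_succ] at h
    linarith
  have hΨ : (27 * PowerSeries.X - 32) * Ψ = 27 * PowerSeries.X * Φ - 40 := by
    rw [sub_mul, mul_assoc, mul_assoc]
    ext m
    rw [map_sub, map_sub, nat, nat, nat]
    have h40 : PowerSeries.coeff m (40 : PowerSeries ℝ) = if m = 0 then 40 else 0 := by
      rw [← map_ofNat (PowerSeries.C (R := ℝ)) 40, PowerSeries.coeff_C]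
    rw [h40]
    cases m with
    | zero => simp [hΨd, splitWeight]; norm_num
    | succ m =>
      rw [PowerSeries.coeff_succ_X_mul, PowerSeries.coeff_succ_X_mul, if_neg (by omega)]
      simp only [hΦd, hΨd, PowerSeries.coeff_mk]
      linarith [splitWeight_eq m]
  have key : (27 * PowerSeries.X - 32) *
      (9 * (8 * Φ - 8 - PowerSeries.X * Φ - PowerSeries.X * (Φ - 1) * Ψ)) = 0 := by
    set C := scaledCatalan
    have hC := scaledCatalan_eq
    set X : PowerSeries ℝ := PowerSeries.X
    have h1 : (27 * X - 32) * (24 * (3 * Φ) - 72 - 3 * X * (3 * Φ)) -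
        X * (3 * (3 * Φ) - 9) * (9 * X * (3 * Φ) - 40) = 0 := by
      rw [hΦ]
      linear_combination (9 * (4 - C) ^ 2 * X - 144 + 48 * C) * hC
    linear_combination h1 - 9 * X * (Φ - 1) * hΨ
  have h0 : 8 * Φ = 8 + PowerSeries.X * (Φ + (Φ - 1) * Ψ) := by
    rcases mul_eq_zero.1 key with h | h
    · have := congrArg (PowerSeries.coeff 1) h
      have h32 : PowerSeries.coeff 1 (32 : PowerSeries ℝ) = 0 := by
        rw [← map_ofNat (PowerSeries.C (R := ℝ)) 32, PowerSeries.coeff_C, if_neg (by omega)]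
      rw [map_sub, nat, h32, PowerSeries.coeff_one_X] at this
      norm_num at this
    · have h9 : (9 : PowerSeries ℝ) ≠ 0 := by
        intro h
        have := congrArg (PowerSeries.coeff 0) h
        rw [← map_ofNat (PowerSeries.C (R := ℝ)) 9, PowerSeries.coeff_C] at this
        norm_num at this
      have := (mul_eq_zero.1 h).resolve_left h9
      linear_combination this
  have h := congrArg (PowerSeries.coeff (m + 1)) h0
  have h8 : PowerSeries.coeff (m + 1) (8 : PowerSeries ℝ) = 0 := by
    rw [← map_ofNat (PowerSeries.C (R := ℝ)) 8, PowerSeries.coeff_C, if_neg (by omega)]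
  rw [nat, map_add, h8, PowerSeries.coeff_succ_X_mul, map_add, PowerSeries.coeff_mul] at h
  have h2 : ∀ x ∈ antidiagonal m, PowerSeries.coeff x.1 (Φ - 1) * PowerSeries.coeff x.2 Ψ =
      (if x.1 = 0 then 0 else topWeight x.1) * splitWeight x.2 := by
    intro x _
    rw [map_sub, PowerSeries.coeff_one]
    simp only [hΦd, hΨd, PowerSeries.coeff_mk]
    split_ifs with hx
    · rw [hx, topWeight_zero, sub_self]
    · rw [sub_zero]
  rw [Finset.sum_congr rfl h2] at h
  simp only [hΦd, PowerSeries.coeff_mk] at h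
  linarith

theorem sum_le_of_recurrence (P Q : ℕ → ℕ → ℕ) (hP00 : P 0 0 ≤ 1)
    (hP0 : ∀ m, P 0 (m + 1) = 0) (hPz : ∀ n, P (n + 1) 0 = 0)
    (hP : ∀ n m, P (n + 1) (m + 1) ≤ P n m + ∑ x ∈ antidiagonal m,
      if x.1 = 0 then 0 else ∑ y ∈ antidiagonal n, P y.1 x.1 * Q y.2 x.2)
    (hQz : ∀ n c, n < c → Q n c = 0)
    (hQ : ∀ n c, Q n c ≤ P n c + ∑ y ∈ antidiagonal n,
      (∑ i ∈ range (y.1 + 1), P y.1 i) * Q y.2 (c + 1)) (n : ℕ) :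
    (∑ i ∈ range (n + 1), P n i : ℝ) ≤ 2 * 8 ^ n := by
  have hconv : ∀ (f g : ℕ → ℕ) (N : ℕ),
      ∑ n ∈ range N, (∑ y ∈ antidiagonal n, (f y.1 * g y.2 : ℝ)) / 8 ^ n ≤
        (∑ n ∈ range N, (f n : ℝ) / 8 ^ n) * ∑ n ∈ range N, (g n : ℝ) / 8 ^ n := by
    intro f g N
    refine le_trans (le_of_eq ?_) (sum_antidiagonal_le (fun n => (f n : ℝ) / 8 ^ n)
      (fun n => (g n : ℝ) / 8 ^ n) (fun n => by positivity) (fun n => by positivity) N)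
    refine Finset.sum_congr rfl fun n _ => ?_
    rw [Finset.sum_div]
    refine Finset.sum_congr rfl fun x hx => ?_
    rw [← mem_antidiagonal.1 hx, pow_add]
    field_simp
  have hsum : ∀ N, (∀ m, ∑ n ∈ range N, (P n m : ℝ) / 8 ^ n ≤ topWeight m) →
      ∑ n ∈ range N, ((∑ i ∈ range (n + 1), P n i : ℕ) : ℝ) / 8 ^ n ≤ 32 / 27 := by
    intro N hN
    calc ∑ n ∈ range N, ((∑ i ∈ range (n + 1), P n i : ℕ) : ℝ) / 8 ^ n
        ≤ ∑ n ∈ range N, ∑ i ∈ range N, (P n i : ℝ) / 8 ^ n := by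
          refine Finset.sum_le_sum fun n hn => ?_
          push_cast
          rw [Finset.sum_div]
          refine Finset.sum_le_sum_of_subset_of_nonneg ?_ fun _ _ _ => by positivity
          exact Finset.range_subset_range.2 (by simpa using hn)
      _ = ∑ i ∈ range N, ∑ n ∈ range N, (P n i : ℝ) / 8 ^ n := Finset.sum_comm
      _ ≤ ∑ i ∈ range N, topWeight i := Finset.sum_le_sum fun i _ => hN i
      _ ≤ 32 / 27 := sum_topWeight_le N
  have hQle : ∀ N, (∀ m, ∑ n ∈ range N, (P n m : ℝ) / 8 ^ n ≤ topWeight m) →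
      ∀ k c, N ≤ c + k → ∑ n ∈ range N, (Q n c : ℝ) / 8 ^ n ≤ splitWeight c := by
    intro N hN k
    induction k with
    | zero =>
      intro c hc
      rw [Finset.sum_eq_zero]
      · exact splitWeight_nonneg c
      · intro n hn
        rw [hQz n c (by have := mem_range.1 hn; omega)]
        simp
    | succ k ih =>
      intro c hc
      have h1 := ih (c + 1) (by omega)
      have h2 := hconv (fun n => ∑ i ∈ range (n + 1), P n i) (fun n => Q n (c + 1)) N
      have h3 : 0 ≤ ∑ n ∈ range N, (Q n (c + 1) : ℝ) / 8 ^ n :=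
        Finset.sum_nonneg fun _ _ => by positivity
      have h4 := mul_le_mul (hsum N hN) h1 h3 (by norm_num)
      calc ∑ n ∈ range N, (Q n c : ℝ) / 8 ^ n
          ≤ ∑ n ∈ range N, ((P n c : ℝ) / 8 ^ n + (∑ y ∈ antidiagonal n,
              (((∑ i ∈ range (y.1 + 1), P y.1 i : ℕ) : ℝ) * (Q y.2 (c + 1) : ℝ))) / 8 ^ n) := by
            refine Finset.sum_le_sum fun n _ => ?_
            rw [← add_div]
            gcongr
            exact_mod_cast hQ n c
        _ ≤ topWeight c + 32 / 27 * splitWeight (c + 1) := by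
            rw [Finset.sum_add_distrib]
            exact add_le_add (hN c) (h2.trans h4)
        _ = splitWeight c := (splitWeight_eq c).symm
  have hPle : ∀ N m, ∑ n ∈ range N, (P n m : ℝ) / 8 ^ n ≤ topWeight m := by
    intro N
    induction N with
    | zero => intro m; simpa using topWeight_nonneg m
    | succ N ih =>
      intro m
      rw [Finset.sum_range_succ']
      cases m with
      | zero =>
        simp only [hPz, topWeight_zero]
        have : (P 0 0 : ℝ) ≤ 1 := by exact_mod_cast hP00
        simpa using this
      | succ m =>
        rw [hP0 m, topWeight_succ]
        have h1 : ∀ x ∈ antidiagonal m, (if x.1 = 0 then 0 else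
            ∑ n ∈ range N, (∑ y ∈ antidiagonal n, (P y.1 x.1 * Q y.2 x.2 : ℝ)) / 8 ^ n) ≤
            (if x.1 = 0 then 0 else topWeight x.1) * splitWeight x.2 := by
          intro x _
          split_ifs
          · simp
          · exact (hconv (fun n => P n x.1) (fun n => Q n x.2) N).trans
              (mul_le_mul (ih x.1) (hQle N ih N x.2 (by omega))
                (Finset.sum_nonneg fun _ _ => by positivity) (topWeight_nonneg _))
        have h2 : ∑ n ∈ range N, (P (n + 1) (m + 1) : ℝ) / 8 ^ (n + 1) ≤
            ∑ n ∈ range N, 1 / 8 * ((P n m : ℝ) / 8 ^ n + ∑ x ∈ antidiagonal m, if x.1 = 0 then 0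
              else (∑ y ∈ antidiagonal n, (P y.1 x.1 * Q y.2 x.2 : ℝ)) / 8 ^ n) := by
          refine Finset.sum_le_sum fun n _ => ?_
          have h : (P (n + 1) (m + 1) : ℝ) ≤ P n m + ∑ x ∈ antidiagonal m,
              if x.1 = 0 then 0 else ∑ y ∈ antidiagonal n, (P y.1 x.1 * Q y.2 x.2 : ℝ) := by
            exact_mod_cast hP n m
          have h' : (∑ x ∈ antidiagonal m, if x.1 = 0 then 0
              else (∑ y ∈ antidiagonal n, (P y.1 x.1 * Q y.2 x.2 : ℝ)) / 8 ^ n) =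
              (∑ x ∈ antidiagonal m, if x.1 = 0 then 0
              else (∑ y ∈ antidiagonal n, (P y.1 x.1 * Q y.2 x.2 : ℝ))) / 8 ^ n := by
            rw [Finset.sum_div]
            refine Finset.sum_congr rfl fun x _ => ?_
            split_ifs <;> simp
          rw [h', ← add_div, pow_succ, mul_comm ((8 : ℝ) ^ n) 8, ← div_div, div_right_comm,
            div_eq_mul_one_div _ (8 : ℝ), mul_comm _ (1 / 8 : ℝ)]
          gcongr
        rw [← Finset.mul_sum, Finset.sum_add_distrib, Finset.sum_comm] at h2
        have h3 : ∑ x ∈ antidiagonal m, ∑ n ∈ range N, (if x.1 = 0 then 0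
              else (∑ y ∈ antidiagonal n, (P y.1 x.1 * Q y.2 x.2 : ℝ)) / 8 ^ n) ≤
            ∑ x ∈ antidiagonal m, (if x.1 = 0 then 0 else topWeight x.1) * splitWeight x.2 := by
          refine Finset.sum_le_sum fun x hx => le_trans (le_of_eq ?_) (h1 x hx)
          split_ifs <;> simp
        have h4 := ih m
        simp only [Nat.cast_zero, zero_div, add_zero]
        linarith
  have h := hsum (n + 1) (hPle (n + 1))
  rw [Finset.sum_range_succ] at h
  have h1 : 0 ≤ ∑ n ∈ range n, ((∑ i ∈ range (n + 1), P n i : ℕ) : ℝ) / 8 ^ n :=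
    Finset.sum_nonneg fun _ _ => by positivity
  have h2 : ((∑ i ∈ range (n + 1), P n i : ℕ) : ℝ) / 8 ^ n ≤ 2 := by linarith
  rw [div_le_iff₀ (by positivity)] at h2
  exact_mod_cast h2

/-- The number of entries of `l` larger than `a`. -/
def numAbove (l : List ℕ) (a : ℕ) : ℕ := l.countP (a < ·)

/-- `a` is the last entry of an occurrence of 231 in `l`. -/
def Ends231 (l : List ℕ) (a : ℕ) : Prop := ∃ b c, [b, c, a].Sublist l ∧ a < b ∧ b < c

/-- `l` has no subsequence that is order-isomorphic to 1342. -/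
def Avoids1342 (l : List ℕ) : Prop :=
  ∀ a b c d, [a, b, c, d].Sublist l → a < d → d < b → ¬ b < c

/-- `l` has `k` largest entries, and these avoid 231. -/
def TopAvoids (l : List ℕ) (k : ℕ) : Prop :=
  k ≤ l.length ∧ ∀ a, Ends231 l a → k ≤ numAbove l a

/-- `k` is the largest number of top entries of `l` that avoid 231. -/
def HasTopStat (l : List ℕ) (k : ℕ) : Prop := TopAvoids l k ∧ ¬ TopAvoids l (k + 1)

/-- The pair `(L, R)` arises by deleting the maximum `n` from a 1342-avoiding word `L ++ n :: R`,
each entry of `L` is below at least `c` entries of `R`, and the top `d` entries of `R`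
avoid 231. -/
structure IsSplit (L R : List ℕ) (c d : ℕ) : Prop where
  avoids : Avoids1342 (L ++ R)
  separated : ∀ a b r, [a, b].Sublist L → r ∈ R → a < r → ¬ r < b
  above : ∀ x ∈ L, c ≤ numAbove R x
  top : TopAvoids R d

theorem Avoids1342.sublist {l l' : List ℕ} (h : Avoids1342 l) (hs : l'.Sublist l) :
    Avoids1342 l' := fun a b c d h' => h a b c d (h'.trans hs)

theorem topAvoids_zero (l : List ℕ) : TopAvoids l 0 := ⟨Nat.zero_le _, fun _ _ => Nat.zero_le _⟩

theorem TopAvoids.mono {l : List ℕ} {k m : ℕ} (h : TopAvoids l m) (hkm : k ≤ m) :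
    TopAvoids l k := ⟨hkm.trans h.1, fun a ha => hkm.trans (h.2 a ha)⟩

theorem exists_hasTopStat (l : List ℕ) : ∃ k ≤ l.length, HasTopStat l k := by
  classical
  refine ⟨Nat.findGreatest (TopAvoids l) l.length, Nat.findGreatest_le _,
    Nat.findGreatest_spec (Nat.zero_le _) (topAvoids_zero l), fun h => ?_⟩
  have := Nat.le_findGreatest h.1 h
  omega

theorem HasTopStat.unique {l : List ℕ} {k m : ℕ} (hk : HasTopStat l k) (hm : HasTopStat l m) :
    k = m := by
  by_contra hne
  rcases Nat.lt_or_gt_of_ne hne with h | h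
  · exact hk.2 (hm.1.mono h)
  · exact hm.2 (hk.1.mono h)

theorem numAbove_anti (l : List ℕ) {a b : ℕ} (h : a ≤ b) : numAbove l b ≤ numAbove l a :=
  List.countP_mono_left fun x _ hx => by
    simp only [decide_eq_true_eq] at *
    omega

theorem numAbove_append (l l' : List ℕ) (a : ℕ) :
    numAbove (l ++ l') a = numAbove l a + numAbove l' a := List.countP_append

theorem numAbove_lt {l : List ℕ} {a b : ℕ} (hb : b ∈ l) (h : a < b) :
    numAbove l b < numAbove l a := by
  have hsub : numAbove l b + l.countP (b = ·) ≤ numAbove l a := by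
    unfold numAbove
    induction l with
    | nil => simp
    | cons x t ih =>
      simp only [List.countP_cons, decide_eq_true_eq]
      by_cases hbt : b ∈ t
      · have := ih hbt
        split_ifs <;> omega
      · have h1 : t.countP (b = ·) = 0 := by
          rw [List.countP_eq_zero]
          intro y hy
          simp only [decide_eq_true_eq]
          rintro rfl
          exact hbt hy
        have h2 := numAbove_anti t h.le
        unfold numAbove at h2
        split_ifs <;> omega
  have : 0 < l.countP (b = ·) := List.countP_pos_iff.2 ⟨b, hb, by simp⟩
  omega

theorem numAbove_eq_length {l : List ℕ} {a : ℕ} (h : ∀ x ∈ l, a < x) :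
    numAbove l a = l.length := List.countP_eq_length.2 fun x hx => by simpa using h x hx

theorem numAbove_eq_zero {l : List ℕ} {a : ℕ} (h : ∀ x ∈ l, x ≤ a) :
    numAbove l a = 0 := List.countP_eq_zero.2 fun x hx => by simpa using h x hx

theorem numAbove_le_length (l : List ℕ) (a : ℕ) : numAbove l a ≤ l.length := List.countP_le_length

/-- If the larger of two counts is attained at `a`, some entry lies strictly between. -/
theorem exists_between_of_numAbove_lt {l : List ℕ} {a b : ℕ} (h : numAbove l b < numAbove l a) :
    ∃ r ∈ l, a < r ∧ r ≤ b := by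
  by_contra hno
  push Not at hno
  refine absurd (List.countP_mono_left (l := l) (p := (a < ·)) (q := (b < ·)) ?_)
    (not_le.2 h)
  intro x hx hax
  simp only [decide_eq_true_eq] at *
  exact hno x hx hax

theorem eq_filter_append_filter {l : List ℕ} (p : ℕ → Bool)
    (h : ∀ a b, [a, b].Sublist l → p b → p a) :
    l = l.filter p ++ l.filter (fun x => !p x) := by
  induction l with
  | nil => rfl
  | cons x t ih =>
    by_cases hx : p x
    · have := ih fun a b hab => h a b (hab.cons x)
      simp only [hx, List.filter_cons_of_pos, List.cons_append, Bool.not_true, Bool.false_eq_true,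
        not_false_eq_true, List.filter_cons_of_neg]
      rw [← this]
    · have ht : ∀ b ∈ t, ¬ p b := fun b hb hpb =>
        hx (h x b ((List.singleton_sublist.2 hb).cons_cons x) hpb)
      have h1 : t.filter p = [] := List.filter_eq_nil_iff.2 ht
      have h2 : t.filter (fun x => !p x) = t :=
        List.filter_eq_self.2 fun b hb => by simpa using ht b hb
      simp [hx, h1, h2]

section map

variable {f : ℕ → ℕ}

theorem numAbove_map (hf : StrictMono f) (l : List ℕ) (a : ℕ) :
    numAbove (l.map f) (f a) = numAbove l a := by
  simp [numAbove, List.countP_map, Function.comp_def, hf.lt_iff_lt]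

theorem map_sublist_map_iff (hf : StrictMono f) {l l' : List ℕ} :
    (l.map f).Sublist (l'.map f) ↔ l.Sublist l' := by
  refine ⟨fun h => ?_, fun h => h.map f⟩
  obtain ⟨l'', h1, h2⟩ := List.sublist_map_iff.1 h
  rwa [List.map_injective_iff.2 hf.injective h2]

theorem Avoids1342.of_map (hf : StrictMono f) {l : List ℕ} (h : Avoids1342 (l.map f)) :
    Avoids1342 l := fun _ _ _ _ hs h1 h2 h3 =>
  h _ _ _ _ ((map_sublist_map_iff hf).2 hs) (hf h1) (hf h2) (hf h3)

theorem ends231_map_iff (hf : StrictMono f) {l : List ℕ} {a : ℕ} :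
    Ends231 (l.map f) (f a) ↔ Ends231 l a := by
  constructor
  · rintro ⟨b, c, hs, h1, h2⟩
    have hb : b ∈ l.map f := hs.subset (by simp)
    have hc : c ∈ l.map f := hs.subset (by simp)
    obtain ⟨b, -, rfl⟩ := List.mem_map.1 hb
    obtain ⟨c, -, rfl⟩ := List.mem_map.1 hc
    exact ⟨b, c, (map_sublist_map_iff hf).1 hs, hf.lt_iff_lt.1 h1, hf.lt_iff_lt.1 h2⟩
  · rintro ⟨b, c, hs, h1, h2⟩
    exact ⟨f b, f c, hs.map f, hf h1, hf h2⟩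

theorem Ends231.mem {l : List ℕ} {a : ℕ} (h : Ends231 l a) : a ∈ l := by
  obtain ⟨b, c, hs, -⟩ := h
  exact hs.subset (by simp)

theorem topAvoids_map_iff (hf : StrictMono f) {l : List ℕ} {k : ℕ} :
    TopAvoids (l.map f) k ↔ TopAvoids l k := by
  unfold TopAvoids
  rw [List.length_map]
  refine and_congr_right fun _ => ⟨fun h a ha => ?_, fun h a ha => ?_⟩
  · rw [← numAbove_map hf]
    exact h _ ((ends231_map_iff hf).2 ha)
  · obtain ⟨a, -, rfl⟩ := List.mem_map.1 ha.mem
    rw [numAbove_map hf]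
    exact h _ ((ends231_map_iff hf).1 ha)

theorem hasTopStat_map_iff (hf : StrictMono f) {l : List ℕ} {k : ℕ} :
    HasTopStat (l.map f) k ↔ HasTopStat l k := by
  unfold HasTopStat
  rw [topAvoids_map_iff hf, topAvoids_map_iff hf]

theorem IsSplit.of_map (hf : StrictMono f) {L R : List ℕ} {c d : ℕ}
    (h : IsSplit (L.map f) (R.map f) c d) : IsSplit L R c d where
  avoids := Avoids1342.of_map hf (by rw [List.map_append]; exact h.avoids)
  separated a b r hs hr h1 h2 := h.separated _ _ _ ((map_sublist_map_iff hf).2 hs)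
    (List.mem_map_of_mem hr) (hf h1) (hf h2)
  above x hx := numAbove_map hf R x ▸ h.above _ (List.mem_map_of_mem hx)
  top := (topAvoids_map_iff hf).1 h.top

end map

/-- The words listing each element of `V` once. -/
def words (V : Finset ℕ) : Finset (List ℕ) := V.val.lists.toFinset

theorem mem_words {V : Finset ℕ} {l : List ℕ} : l ∈ words V ↔ l.Nodup ∧ l.toFinset = V := by
  rw [words, Multiset.mem_toFinset, Multiset.mem_lists_iff]
  constructor
  · intro h
    have hn : l.Nodup := by
      have := V.nodup
      rw [h] at this
      exact Multiset.coe_nodup.1 this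
    exact ⟨hn, by ext x; rw [List.mem_toFinset, ← Finset.mem_val, h]; rfl⟩
  · rintro ⟨hn, rfl⟩
    simp [List.toFinset_val, hn.dedup]

theorem length_of_mem_words {V : Finset ℕ} {l : List ℕ} (h : l ∈ words V) : l.length = #V := by
  obtain ⟨h1, rfl⟩ := mem_words.1 h
  exact (List.toFinset_card_of_nodup h1).symm

open Classical in
/-- The pairs of words that together list each element of `V` once. -/
noncomputable def wordPairs (V : Finset ℕ) : Finset (List ℕ × List ℕ) :=
  V.powerset.biUnion fun U => words U ×ˢ words (V \ U)

theorem mem_wordPairs {V : Finset ℕ} {x : List ℕ × List ℕ} :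
    x ∈ wordPairs V ↔ x.1 ++ x.2 ∈ words V := by
  simp only [wordPairs, mem_biUnion, mem_powerset, mem_product, mem_words, List.nodup_append',
    List.toFinset_append]
  constructor
  · rintro ⟨U, hU, ⟨h1, h2⟩, h3, h4⟩
    refine ⟨⟨h1, h3, ?_⟩, by rw [h2, h4]; exact Finset.union_sdiff_of_subset hU⟩
    rw [← List.disjoint_toFinset_iff_disjoint, h2, h4]
    exact Finset.disjoint_sdiff
  · rintro ⟨⟨h1, h2, h3⟩, h4⟩
    refine ⟨x.1.toFinset, h4 ▸ subset_union_left, ⟨h1, rfl⟩, h2, ?_⟩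
    rw [← h4, Finset.union_sdiff_cancel_left]
    exact List.disjoint_toFinset_iff_disjoint.2 h3

open Classical in
/-- The 1342-avoiding words on `V` with top statistic `m`. -/
noncomputable def topClass (V : Finset ℕ) (m : ℕ) : Finset (List ℕ) :=
  {l ∈ words V | Avoids1342 l ∧ HasTopStat l m}

open Classical in
/-- The splits of words on `V` in which the left part is below `c + 1` entries of the right. -/
noncomputable def splitClass (V : Finset ℕ) (c : ℕ) : Finset (List ℕ × List ℕ) :=
  {x ∈ wordPairs V | IsSplit x.1 x.2 (c + 1) c}

theorem exists_strictMono_image_range (V : Finset ℕ) :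
    ∃ f : ℕ → ℕ, StrictMono f ∧ (range #V).image f = V := by
  refine ⟨fun i => if h : i < #V then V.orderEmbOfFin rfl ⟨i, h⟩ else V.sup id + 1 + i, ?_, ?_⟩
  · intro i j hij
    dsimp only
    split_ifs with h1 h2 h2
    · exact (V.orderEmbOfFin rfl).strictMono hij
    · have := Finset.le_sup (f := id) (V.orderEmbOfFin_mem rfl ⟨i, h1⟩)
      simp only [id] at this
      omega
    · omega
    · omega
  · ext x
    simp only [mem_image, mem_range]
    constructor
    · rintro ⟨i, hi, rfl⟩
      rw [dif_pos hi]
      exact V.orderEmbOfFin_mem rfl _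
    · intro hx
      have : x ∈ Set.range (V.orderEmbOfFin rfl) := by rw [V.range_orderEmbOfFin]; exact hx
      obtain ⟨i, rfl⟩ := this
      exact ⟨i, i.2, by rw [dif_pos i.2]⟩

theorem exists_map_of_mem_words {V W : Finset ℕ} {f : ℕ → ℕ} (hf : StrictMono f)
    (hV : W.image f = V) {l : List ℕ} (hl : l ∈ words V) : ∃ l' ∈ words W, List.map f l' = l := by
  obtain ⟨h1, h2⟩ := mem_words.1 hl
  have : ∀ x ∈ l, x ∈ Set.range f := by
    intro x hx
    rw [← List.mem_toFinset, h2, ← hV] at hx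
    obtain ⟨y, -, rfl⟩ := mem_image.1 hx
    exact ⟨y, rfl⟩
  obtain ⟨l', rfl⟩ : ∃ l' : List ℕ, l'.map f = l := by
    have h : l ∈ Set.range (List.map f) := by rw [Set.range_list_map]; exact this
    exact h
  refine ⟨l', mem_words.2 ⟨h1.of_map f, ?_⟩, rfl⟩
  apply Finset.image_injective hf.injective
  rw [hV, ← h2]
  ext; simp

theorem card_topClass_le (V : Finset ℕ) (m : ℕ) : #(topClass V m) ≤ #(topClass (range #V) m) := by
  classical
  obtain ⟨f, hf, hV⟩ := exists_strictMono_image_range V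
  refine (Finset.card_le_card (t := (topClass (range #V) m).image (List.map f)) ?_).trans
    Finset.card_image_le
  intro l hl
  simp only [topClass, mem_filter, mem_image] at *
  obtain ⟨l', h1, rfl⟩ := exists_map_of_mem_words hf hV hl.1
  exact ⟨l', ⟨h1, hl.2.1.of_map hf, (hasTopStat_map_iff hf).1 hl.2.2⟩, rfl⟩

theorem card_splitClass_le (V : Finset ℕ) (c : ℕ) :
    #(splitClass V c) ≤ #(splitClass (range #V) c) := by
  classical
  obtain ⟨f, hf, hV⟩ := exists_strictMono_image_range V
  refine (Finset.card_le_card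
    (t := (splitClass (range #V) c).image (Prod.map (List.map f) (List.map f))) ?_).trans
    Finset.card_image_le
  rintro ⟨L, R⟩ hl
  simp only [splitClass, mem_filter, mem_image, mem_wordPairs] at *
  obtain ⟨l', h1, h2⟩ := exists_map_of_mem_words hf hV hl.1
  obtain ⟨L', R', rfl, rfl, rfl⟩ := List.map_eq_append_iff.1 h2
  exact ⟨(L', R'), ⟨h1, hl.2.of_map hf⟩, rfl⟩

theorem numAbove_of_mem_words {n : ℕ} {l : List ℕ} (h : l ∈ words (range n)) {v : ℕ}
    (hv : v < n) : numAbove l v + v + 1 = n := by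
  obtain ⟨h1, h2⟩ := mem_words.1 h
  have h3 : (l.filter (v < ·)).toFinset = Ioo v n := by
    ext x
    have : x ∈ l ↔ x < n := by rw [← List.mem_toFinset, h2, mem_range]
    simp [this, and_comm]
  have h4 := congrArg Finset.card h3
  rw [List.toFinset_card_of_nodup (h1.filter _), Nat.card_Ioo, ← List.countP_eq_length_filter] at h4
  unfold numAbove
  omega

/-- The left part of a split breaks up into the entries below exactly `c` entries of the right
part, which form an interval, followed by the remaining smaller entries. -/
theorem IsSplit.exists_append {n : ℕ} {L R : List ℕ} {c : ℕ} (hw : L ++ R ∈ words (range n))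
    (h : IsSplit L R c c) : ∃ L₁ L₂, L = L₁ ++ L₂ ∧ (∀ x ∈ L₁, numAbove R x = c) ∧
      (∀ x ∈ L₂, c + 1 ≤ numAbove R x) ∧ c + L₁.length ≤ n ∧
      L₁ ∈ words (Ico (n - c - L₁.length) (n - c)) ∧ IsSplit L₂ R (c + 1) c := by
  obtain ⟨hnd, hfin⟩ := mem_words.1 hw
  have hdisj := (List.nodup_append'.1 hnd).2.2
  set p : ℕ → Bool := fun x => numAbove R x = c with hp
  have hL := eq_filter_append_filter (l := L) p (by
    intro a b hab hb
    simp only [hp, decide_eq_true_eq] at *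
    by_contra hne
    have ha := h.above a (hab.subset (by simp))
    obtain ⟨r, hr, h1, h2⟩ := exists_between_of_numAbove_lt (l := R) (a := a) (b := b) (by omega)
    refine h.separated a b r hab hr h1 (lt_of_le_of_ne h2 ?_)
    rintro rfl
    exact hdisj (hab.subset (by simp)) hr)
  set L₁ := L.filter p with hL1
  set L₂ := L.filter (fun x => !p x) with hL2
  have hs1 : L₁.Sublist L := List.filter_sublist
  have hs2 : L₂.Sublist L := List.filter_sublist
  have e1 : ∀ x ∈ L₁, numAbove R x = c := by
    intro x hx
    simpa [hp] using (List.mem_filter.1 hx).2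
  have e2 : ∀ x ∈ L₂, c + 1 ≤ numAbove R x := by
    intro x hx
    have h1 := List.mem_filter.1 hx
    have h2 := h.above x h1.1
    have h3 : numAbove R x ≠ c := by simpa [hp] using h1.2
    omega
  have hlen := length_of_mem_words hw
  have hle := hs1.length_le
  have hR := h.top.1
  rw [List.length_append, card_range] at hlen
  refine ⟨L₁, L₂, hL, e1, e2, by omega, ?_, ⟨?_, ?_, e2, h.top⟩⟩
  · have hnd1 : L₁.Nodup := (List.nodup_append'.1 hnd).1.sublist hs1
    refine mem_words.2 ⟨hnd1, Finset.eq_of_subset_of_card_le ?_ ?_⟩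
    · intro x hx
      rw [List.mem_toFinset] at hx
      have hxn : x < n := by
        rw [← mem_range, ← hfin, List.mem_toFinset]
        exact List.mem_append_left _ (hs1.subset hx)
      have h1 := numAbove_of_mem_words hw hxn
      have h2 : numAbove L₂ x = 0 := numAbove_eq_zero fun y hy => by
        by_contra hlt
        have := numAbove_anti R (not_le.1 hlt).le
        have := e1 x hx
        have := e2 y hy
        omega
      rw [hL, numAbove_append, numAbove_append, e1 x hx, h2] at h1
      have h3 : numAbove L₁ x < L₁.length :=
        lt_of_le_of_ne (numAbove_le_length _ _) fun h => by
          simpa using List.countP_eq_length.1 h x hx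
      rw [mem_Ico]
      omega
    · rw [List.toFinset_card_of_nodup hnd1, Nat.card_Ico]
      omega
  · exact h.avoids.sublist (hs2.append_right R)
  · exact fun a b r hs => h.separated a b r (hs.trans hs2)

theorem IsSplit.left_eq_nil {L R : List ℕ} {c : ℕ} (h : IsSplit L R (c + 1) c)
    (ht : ¬ TopAvoids R (c + 1)) : L = [] := by
  rw [List.eq_nil_iff_forall_not_mem]
  intro l hl
  have h1 := h.above l hl
  refine ht ⟨h1.trans (numAbove_le_length _ _), fun a ha => ?_⟩
  by_contra hlt
  have hla : l < a := by
    by_contra hle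
    have := numAbove_anti R (not_lt.1 hle)
    omega
  obtain ⟨b, d, hs, h2, h3⟩ := ha
  exact h.avoids l b d a ((List.singleton_sublist.2 hl).append hs) hla h2 h3

theorem card_band {n c s t : ℕ} (h : s + t = n) (hc : c + s ≤ n) :
    #(Ico (n - c - s) (n - c)) = s ∧ #(range n \ Ico (n - c - s) (n - c)) = t := by
  have h1 : #(Ico (n - c - s) (n - c)) = s := by
    rw [Nat.card_Ico]
    omega
  refine ⟨h1, ?_⟩
  rw [card_sdiff_of_subset, h1, card_range]
  · omega
  · intro x
    simp only [mem_Ico, mem_range]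
    omega

theorem mem_words_sdiff {V : Finset ℕ} {l l' : List ℕ} (h : l ++ l' ∈ words V) :
    l' ∈ words (V \ l.toFinset) := by
  obtain ⟨h1, h2⟩ := mem_words.1 h
  obtain ⟨h3, h4, h5⟩ := List.nodup_append'.1 h1
  refine mem_words.2 ⟨h4, ?_⟩
  rw [← h2, List.toFinset_append, Finset.union_sdiff_cancel_left]
  exact List.disjoint_toFinset_iff_disjoint.2 h5

theorem splitClass_eq_empty {n c : ℕ} (h : n < c) : splitClass (range n) c = ∅ := by
  simp only [splitClass, mem_wordPairs, Finset.filter_eq_empty_iff]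
  intro x hx hs
  have h1 := length_of_mem_words hx
  have h2 := hs.top.1
  rw [List.length_append, card_range] at h1
  omega

theorem card_splitClass_le_add_sum (n c : ℕ) :
    #(splitClass (range n) c) ≤ #(topClass (range n) c) + ∑ y ∈ antidiagonal n,
      (∑ i ∈ range (y.1 + 1), #(topClass (range y.1) i)) * #(splitClass (range y.2) (c + 1)) := by
  classical
  let band : ℕ → Finset ℕ := fun s => Ico (n - (c + 1) - s) (n - (c + 1))
  have hsub : splitClass (range n) c ⊆ (topClass (range n) c).image (fun l => ([], l)) ∪
      {y ∈ antidiagonal n | c + 1 + y.1 ≤ n}.biUnion fun y =>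
        (((range (y.1 + 1)).biUnion fun i => topClass (band y.1) i) ×ˢ
          splitClass (range n \ band y.1) (c + 1)).image
            fun z => (z.1 ++ z.2.1, z.2.2) := by
    rintro ⟨L, R⟩ hx
    obtain ⟨hw, hx⟩ := mem_filter.1 hx
    rw [mem_wordPairs] at hw
    dsimp only at hw hx
    rw [mem_union]
    by_cases ht : TopAvoids R (c + 1)
    · right
      obtain ⟨L₁, L₂, rfl, h1, h2, h3, h4, h5⟩ :=
        IsSplit.exists_append hw ⟨hx.avoids, hx.separated, hx.above, ht⟩
      have hlen := length_of_mem_words hw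
      rw [List.length_append, List.length_append, card_range] at hlen
      obtain ⟨i, hi, hi'⟩ := exists_hasTopStat L₁
      refine mem_biUnion.2 ⟨(L₁.length, L₂.length + R.length), mem_filter.2 ⟨?_, h3⟩,
        mem_image.2 ⟨(L₁, (L₂, R)), mem_product.2 ⟨mem_biUnion.2 ⟨i, ?_, ?_⟩, ?_⟩, rfl⟩⟩
      · rw [HasAntidiagonal.mem_antidiagonal]
        omega
      · rw [mem_range]
        omega
      · exact mem_filter.2 ⟨h4, hx.avoids.sublist (by simp), hi'⟩
      · refine mem_filter.2 ⟨mem_wordPairs.2 ?_, h5⟩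
        rw [List.append_assoc] at hw
        have := mem_words_sdiff hw
        rwa [(mem_words.1 h4).2] at this
    · left
      obtain rfl := hx.left_eq_nil ht
      exact mem_image.2 ⟨R, mem_filter.2 ⟨hw, hx.avoids, hx.top, ht⟩, rfl⟩
  refine (card_le_card hsub).trans ((card_union_le _ _).trans
    (add_le_add card_image_le (card_biUnion_le.trans ?_)))
  refine (sum_le_sum fun y hy => ?_).trans (sum_le_sum_of_subset (filter_subset _ _))
  obtain ⟨h1, h2⟩ := mem_filter.1 hy
  obtain ⟨h3, h4⟩ := card_band (HasAntidiagonal.mem_antidiagonal.1 h1) h2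
  refine card_image_le.trans ?_
  rw [card_product]
  refine Nat.mul_le_mul (card_biUnion_le.trans (sum_le_sum fun i _ => ?_)) ?_
  · exact (card_topClass_le (band y.1) i).trans_eq (by rw [h3])
  · exact (card_splitClass_le (range n \ band y.1) (c + 1)).trans_eq (by rw [h4])

theorem HasTopStat.eq_nil {l : List ℕ} (h : HasTopStat l 0) : l = [] := by
  by_contra hne
  refine h.2 ⟨List.length_pos_iff.2 hne, ?_⟩
  rintro a ⟨b, c, hs, h1, h2⟩
  exact List.countP_pos_iff.2 ⟨b, hs.subset (by simp), by simpa using h1⟩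

theorem HasTopStat.of_cons {n m : ℕ} {R : List ℕ} (hR : ∀ x ∈ R, x < n)
    (h : HasTopStat (n :: R) (m + 1)) : HasTopStat R m := by
  have hcount : ∀ a ∈ R, numAbove (n :: R) a = numAbove R a + 1 := fun a ha =>
    List.countP_cons_of_pos (by simpa using hR a ha)
  have key : ∀ k, TopAvoids (n :: R) (k + 1) ↔ TopAvoids R k := by
    intro k
    refine and_congr (by simp) ⟨fun h a ha => ?_, fun h a ha => ?_⟩
    · have h1 := hcount a ha.mem
      obtain ⟨b, c, hs, h2⟩ := ha
      have := h a ⟨b, c, hs.cons n, h2⟩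
      omega
    · obtain ⟨b, c, hs, h1, h2⟩ := ha
      rcases List.sublist_cons_iff.1 hs with hs | ⟨r, hr, hs⟩
      · have := h a ⟨b, c, hs, h1, h2⟩
        have := hcount a (hs.subset (by simp))
        omega
      · obtain ⟨rfl, rfl⟩ := List.cons_eq_cons.1 hr
        have := hR c (hs.subset (by simp))
        omega
  exact ⟨(key m).1 h.1, fun h' => h.2 ((key (m + 1)).2 h')⟩

theorem List.Sublist.of_append_of_notMem {l X Y : List ℕ} {a : ℕ}
    (h : (l ++ [a]).Sublist (X ++ Y)) (ha : a ∉ Y) : (l ++ [a]).Sublist X := by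
  obtain ⟨l₁, l₂, h1, h2, h3⟩ := List.sublist_append_iff.1 h
  rcases List.eq_nil_or_concat l₂ with rfl | ⟨l', b, rfl⟩
  · rw [List.append_nil] at h1
    rwa [h1]
  · rw [List.concat_eq_append, ← List.append_assoc] at h1
    obtain ⟨-, h4⟩ := List.append_inj' h1 rfl
    obtain rfl : a = b := by simpa using h4
    exact absurd (h3.subset (by simp)) ha

/-- Deleting the maximum of a 1342-avoiding word not starting with its maximum gives a split. -/
theorem Avoids1342.exists_isSplit {n : ℕ} {L R : List ℕ} (h : Avoids1342 (L ++ n :: R))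
    (hL : ∀ x ∈ L, x < n) (hne : L ≠ []) :
    ∃ c, IsSplit L R c c ∧ ∃ x ∈ L, numAbove R x = c := by
  obtain ⟨x, hx, hmin⟩ := Finset.exists_min_image L.toFinset (numAbove R)
    (List.toFinset_nonempty_iff L |>.2 hne)
  simp only [List.mem_toFinset] at hx hmin
  refine ⟨numAbove R x, ⟨h.sublist ?_, ?_, hmin, numAbove_le_length _ _, ?_⟩, x, hx, rfl⟩
  · exact (List.sublist_cons_self n R).append_left L
  · intro a b r hs hr h1 h2
    exact h a b n r (hs.append ((List.singleton_sublist.2 hr).cons_cons n)) h1 h2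
      (hL b (hs.subset (by simp)))
  · intro a ha
    by_contra hlt
    have hxa : x < a := by
      by_contra hle
      have := numAbove_anti R (not_lt.1 hle)
      omega
    obtain ⟨b, d, hs, h2, h3⟩ := ha
    exact h x b d a ((List.singleton_sublist.2 hx).append (hs.cons n)) hxa h2 h3

theorem hasTopStat_append_cons {n c i : ℕ} {L₁ L₂ R : List ℕ}
    (hw : L₁ ++ L₂ ++ R ∈ words (range n)) (hav : Avoids1342 (L₁ ++ L₂ ++ n :: R))
    (h1 : ∀ x ∈ L₁, numAbove R x = c) (h2 : ∀ x ∈ L₂, c + 1 ≤ numAbove R x)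
    (hne : L₁ ≠ []) (hi : HasTopStat L₁ i) : HasTopStat (L₁ ++ L₂ ++ n :: R) (c + i + 1) := by
  obtain ⟨hnd, hfin⟩ := mem_words.1 hw
  have hlt : ∀ x, x ∈ L₁ ∨ x ∈ L₂ ∨ x ∈ R → x < n := by
    intro x hx
    rw [← mem_range, ← hfin, List.mem_toFinset]
    simpa [or_assoc] using hx
  obtain ⟨hnd12, hndR, hd⟩ := List.nodup_append'.1 hnd
  obtain ⟨-, -, hd12⟩ := List.nodup_append'.1 hnd12
  have hdR : ∀ x ∈ L₁, x ∉ R := fun x hx hx' => hd (List.mem_append_left _ hx) hx'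
  obtain ⟨x₀, hx₀⟩ := List.exists_mem_of_ne_nil _ hne
  have hlow : ∀ x ∈ L₁, ∀ y ∈ L₂, y < x := by
    intro x hx y hy
    by_contra hle
    have := numAbove_anti R (not_lt.1 hle)
    have := h1 x hx
    have := h2 y hy
    omega
  have hcount : ∀ a < n, numAbove (L₁ ++ L₂ ++ n :: R) a =
      numAbove L₁ a + numAbove L₂ a + (numAbove R a + 1) := by
    intro a ha
    rw [numAbove_append, numAbove_append]
    congr 1
    exact List.countP_cons_of_pos (by simpa using ha)
  have hcR := numAbove_le_length R x₀
  rw [h1 x₀ hx₀] at hcR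
  refine ⟨⟨?_, ?_⟩, fun h => hi.2 ⟨?_, ?_⟩⟩
  · have := hi.1.1
    simp only [List.length_append, List.length_cons]
    omega
  · rintro a ⟨b, d, hs, hab, hbd⟩
    have hmem : ∀ y ∈ L₁ ++ L₂ ++ n :: R, y ≤ n := by
      intro y hy
      simp only [List.mem_append, List.mem_cons] at hy
      rcases hy with (hy | hy) | rfl | hy
      · exact (hlt y (by tauto)).le
      · exact (hlt y (by tauto)).le
      · exact le_rfl
      · exact (hlt y (by tauto)).le
    have han : a < n := hab.trans_le (hmem b (hs.subset (by simp)))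
    rw [hcount a han]
    by_cases ha : a ∈ L₁
    · have hs' : [b, d, a].Sublist L₁ := by
        rw [List.append_assoc] at hs
        refine List.Sublist.of_append_of_notMem (l := [b, d]) hs ?_
        simp only [List.mem_append, List.mem_cons]
        rintro (h | h | h)
        · exact hd12 ha h
        · omega
        · exact hdR a ha h
      have := hi.1.2 a ⟨b, d, hs', hab, hbd⟩
      have := h1 a ha
      omega
    · by_cases hall : ∀ x ∈ L₁, a < x
      · have e1 := numAbove_eq_length hall
        have e2 := numAbove_anti R (hall x₀ hx₀).le
        have e3 := h1 x₀ hx₀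
        have e4 := hi.1.1
        omega
      · push Not at hall
        obtain ⟨x, hx, hxa⟩ := hall
        have hxa : x < a := lt_of_le_of_ne hxa (by rintro rfl; exact ha hx)
        exfalso
        have haR : a ∈ R := by
          have := hs.subset (show a ∈ [b, d, a] by simp)
          simp only [List.mem_append, List.mem_cons] at this
          rcases this with (h | h) | h | h
          · exact absurd h ha
          · exact absurd (hlow x hx a h) (by omega)
          · omega
          · exact h
        obtain ⟨l₁, l₂, e, hs1, hs2⟩ := List.sublist_append_iff.1 hs
        cases l₁ with
        | nil =>
          rw [List.nil_append] at e
          subst e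
          exact hav x b d a ((List.singleton_sublist.2 (List.mem_append_left _ hx)).append hs2)
            hxa hab hbd
        | cons y t =>
          obtain ⟨rfl, -⟩ := List.cons_eq_cons.1 e
          rcases List.mem_append.1 (hs1.subset (List.mem_cons_self)) with hb | hb
          · have e1 := numAbove_lt haR hxa
            have e2 := numAbove_anti R hab.le
            have e3 := h1 x hx
            have e4 := h1 b hb
            omega
          · have := hlow x hx b hb
            omega
  · by_cases hr : ∃ r ∈ R, r < x₀
    · obtain ⟨r, hr, hmax⟩ := Finset.exists_max_image {r ∈ R.toFinset | r < x₀} id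
        (by obtain ⟨r, hr, hr'⟩ := hr; exact ⟨r, by simp [hr, hr']⟩)
      simp only [mem_filter, List.mem_toFinset, id, and_imp] at hr hmax
      have e1 := h.2 r ⟨x₀, n, ((List.singleton_sublist.2 (List.mem_append_left _ hx₀)).append
        ((List.singleton_sublist.2 hr.1).cons_cons n)), hr.2, hlt x₀ (by tauto)⟩
      rw [hcount r (hlt r (by tauto))] at e1
      have e2 : numAbove L₂ r = 0 := numAbove_eq_zero fun y hy => by
        by_contra hyr
        have e3 := h2 y hy
        obtain ⟨z, hz, hz1, hz2⟩ := exists_between_of_numAbove_lt (l := R) (a := y) (b := x₀)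
          (by rw [h1 x₀ hx₀]; omega)
        have := hmax z hz (lt_of_le_of_ne hz2 (by rintro rfl; exact hdR _ hx₀ hz))
        omega
      have e3 : numAbove R r ≤ c := by
        by_contra hlt
        obtain ⟨z, hz, hz1, hz2⟩ := exists_between_of_numAbove_lt (l := R) (a := r) (b := x₀)
          (by rw [h1 x₀ hx₀]; omega)
        have := hmax z hz (lt_of_le_of_ne hz2 (by rintro rfl; exact hdR _ hx₀ hz))
        omega
      have e4 := numAbove_le_length L₁ r
      omega
    · push Not at hr
      have e1 : numAbove R x₀ = R.length := numAbove_eq_length fun r hr' =>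
        lt_of_le_of_ne (hr r hr') (by rintro rfl; exact hdR _ hx₀ hr')
      have e2 : L₂ = [] := by
        rw [List.eq_nil_iff_forall_not_mem]
        intro y hy
        have e3 := h2 y hy
        have e4 := numAbove_le_length R y
        have e5 := h1 x₀ hx₀
        omega
      have e3 := h.1
      have e4 := h1 x₀ hx₀
      simp only [e2, List.length_append, List.length_cons, List.length_nil] at e3
      omega
  · intro a ha
    have haL := ha.mem
    have e1 : numAbove L₂ a = 0 := numAbove_eq_zero fun y hy => (hlow a haL y hy).le
    have e2 := h1 a haL
    obtain ⟨b, d, hs, h3⟩ := ha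
    have e3 := h.2 a ⟨b, d, hs.trans (by simp), h3⟩
    rw [hcount a (hlt a (by tauto))] at e3
    omega

theorem topClass_zero_succ (m : ℕ) : topClass (range 0) (m + 1) = ∅ := by
  simp only [topClass, Finset.filter_eq_empty_iff]
  rintro l hl ⟨-, h⟩
  have h1 := length_of_mem_words hl
  have h2 := h.1.1
  rw [card_range] at h1
  omega

theorem card_topClass_zero_zero : #(topClass (range 0) 0) ≤ 1 := by
  rw [card_le_one]
  intro l hl l' hl'
  simp only [topClass, mem_filter] at hl hl'
  have h1 := length_of_mem_words hl.1
  have h2 := length_of_mem_words hl'.1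
  rw [card_range, List.length_eq_zero_iff] at h1 h2
  rw [h1, h2]

theorem topClass_succ_zero (n : ℕ) : topClass (range (n + 1)) 0 = ∅ := by
  simp only [topClass, Finset.filter_eq_empty_iff]
  rintro l hl ⟨-, h⟩
  have h1 := length_of_mem_words hl
  rw [h.eq_nil, card_range] at h1
  simp at h1

theorem card_topClass_succ_le (n m : ℕ) :
    #(topClass (range (n + 1)) (m + 1)) ≤ #(topClass (range n) m) +
      ∑ x ∈ antidiagonal m, if x.1 = 0 then 0 else ∑ y ∈ antidiagonal n,
        #(topClass (range y.1) x.1) * #(splitClass (range y.2) x.2) := by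
  classical
  let band : ℕ → ℕ → Finset ℕ := fun c s => Ico (n - c - s) (n - c)
  have hsub : topClass (range (n + 1)) (m + 1) ⊆ (topClass (range n) m).image (n :: ·) ∪
      (antidiagonal m).biUnion fun x => if x.1 = 0 then ∅ else
        {y ∈ antidiagonal n | x.2 + y.1 ≤ n}.biUnion fun y =>
          (topClass (band x.2 y.1) x.1 ×ˢ splitClass (range n \ band x.2 y.1) x.2).image
            fun z => z.1 ++ z.2.1 ++ n :: z.2.2 := by
    intro p hp
    obtain ⟨hw, hav, ht⟩ := mem_filter.1 hp
    obtain ⟨hnd, hfin⟩ := mem_words.1 hw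
    have hnp : n ∈ p := by
      rw [← List.mem_toFinset, hfin]
      exact self_mem_range_succ n
    obtain ⟨L, R, rfl⟩ := List.append_of_mem hnp
    have hw' : L ++ R ∈ words (range n) := by
      have hnd' := List.nodup_middle.1 hnd
      refine mem_words.2 ⟨(List.nodup_cons.1 hnd').2, ?_⟩
      ext x
      have h1 : x ∈ (L ++ n :: R).toFinset ↔ x ∈ range (n + 1) := by rw [hfin]
      have h2 := (List.nodup_cons.1 hnd').1
      by_cases hx : x = n
      · subst hx
        simpa using h2
      · simp only [List.mem_toFinset, List.mem_append, List.mem_cons, mem_range, hx,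
          false_or] at h1 ⊢
        rw [h1]
        omega
    have hlt : ∀ x ∈ L ++ R, x < n := by
      intro x hx
      rwa [← mem_range, ← (mem_words.1 hw').2, List.mem_toFinset]
    have hlen := length_of_mem_words hw'
    rw [mem_union]
    by_cases hL : L = []
    · left
      subst hL
      exact mem_image.2 ⟨R, mem_filter.2 ⟨hw', hav.sublist (List.sublist_cons_self n R),
        ht.of_cons hlt⟩, rfl⟩
    · right
      obtain ⟨c, hsplit, x, hx, hxc⟩ := hav.exists_isSplit
        (fun x hx => hlt x (List.mem_append_left _ hx)) hL
      obtain ⟨L₁, L₂, rfl, h1, h2, h3, h4, h5⟩ := hsplit.exists_append hw'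
      have hne : L₁ ≠ [] := by
        rintro rfl
        have := h2 x hx
        omega
      obtain ⟨i, hi, hi'⟩ := exists_hasTopStat L₁
      have hm := ht.unique (hasTopStat_append_cons hw' hav h1 h2 hne hi')
      have hi0 : i ≠ 0 := by
        rintro rfl
        exact hne hi'.eq_nil
      rw [List.length_append, List.length_append, card_range] at hlen
      refine mem_biUnion.2 ⟨(i, c), by rw [HasAntidiagonal.mem_antidiagonal]; omega, ?_⟩
      rw [if_neg hi0]
      refine mem_biUnion.2 ⟨(L₁.length, L₂.length + R.length), mem_filter.2 ⟨?_, h3⟩,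
        mem_image.2 ⟨(L₁, (L₂, R)), mem_product.2 ⟨?_, ?_⟩, rfl⟩⟩
      · rw [HasAntidiagonal.mem_antidiagonal]
        omega
      · exact mem_filter.2 ⟨h4, hav.sublist (by simp), hi'⟩
      · refine mem_filter.2 ⟨mem_wordPairs.2 ?_, h5⟩
        rw [List.append_assoc] at hw'
        have := mem_words_sdiff hw'
        rwa [(mem_words.1 h4).2] at this
  refine (card_le_card hsub).trans ((card_union_le _ _).trans
    (add_le_add card_image_le (card_biUnion_le.trans (sum_le_sum fun x _ => ?_))))
  split_ifs with hx
  · exact le_rfl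
  refine card_biUnion_le.trans ((sum_le_sum fun y hy => ?_).trans
    (sum_le_sum_of_subset (filter_subset _ _)))
  obtain ⟨h1, h2⟩ := mem_filter.1 hy
  obtain ⟨h3, h4⟩ := card_band (HasAntidiagonal.mem_antidiagonal.1 h1) h2
  refine card_image_le.trans ?_
  rw [card_product]
  exact Nat.mul_le_mul ((card_topClass_le (band x.2 y.1) x.1).trans_eq (by rw [h3]))
    ((card_splitClass_le (range n \ band x.2 y.1) x.2).trans_eq (by rw [h4]))

open Classical in
/-- There are at most `2 * 8 ^ n` words avoiding 1342 on a set of `n` letters. -/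
theorem card_avoids1342_le (V : Finset ℕ) :
    (#{l ∈ words V | Avoids1342 l} : ℝ) ≤ 2 * 8 ^ #V := by
  have hle : #{l ∈ words V | Avoids1342 l} ≤ ∑ i ∈ range (#V + 1), #(topClass (range #V) i) := by
    refine (card_le_card (t := (range (#V + 1)).biUnion fun i => topClass V i) ?_).trans
      (card_biUnion_le.trans (sum_le_sum fun i _ => card_topClass_le V i))
    intro l hl
    obtain ⟨h1, h2⟩ := mem_filter.1 hl
    obtain ⟨i, hi, hi'⟩ := exists_hasTopStat l
    rw [length_of_mem_words h1] at hi
    exact mem_biUnion.2 ⟨i, by rw [mem_range]; omega, mem_filter.2 ⟨h1, h2, hi'⟩⟩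
  refine (Nat.cast_le.2 hle).trans ?_
  rw [Nat.cast_sum]
  exact sum_le_of_recurrence (fun n m => #(topClass (range n) m))
    (fun n c => #(splitClass (range n) c)) card_topClass_zero_zero
    (fun m => by rw [topClass_zero_succ, card_empty])
    (fun n => by rw [topClass_succ_zero, card_empty]) card_topClass_succ_le
    (fun n c h => by rw [splitClass_eq_empty h, card_empty]) card_splitClass_le_add_sum #V

/-- The word of Booleans marking the left-to-right minima of `l` that are below `m`. -/
def minMask : ℕ → List ℕ → List Bool
  | _, [] => []
  | m, x :: l => if x < m then true :: minMask x l else false :: minMask m l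

/-- The left-to-right minima of `l` that are below `m`. -/
def minPart : ℕ → List ℕ → List ℕ
  | _, [] => []
  | m, x :: l => if x < m then x :: minPart x l else minPart m l

/-- The entries of `l` other than the left-to-right minima below `m`. -/
def restPart : ℕ → List ℕ → List ℕ
  | _, [] => []
  | m, x :: l => if x < m then restPart x l else x :: restPart m l

theorem length_minMask (m : ℕ) (l : List ℕ) : (minMask m l).length = l.length := by
  induction l generalizing m with
  | nil => rfl
  | cons x l ih =>
    rw [minMask]
    split_ifs <;> simp [ih]

theorem count_minMask (m : ℕ) (l : List ℕ) : (minMask m l).count true = (minPart m l).length := by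
  induction l generalizing m with
  | nil => rfl
  | cons x l ih =>
    rw [minMask, minPart]
    split_ifs <;> simp [ih]

theorem minPart_append_restPart_perm (m : ℕ) (l : List ℕ) :
    (minPart m l ++ restPart m l).Perm l := by
  induction l generalizing m with
  | nil => rfl
  | cons x l ih =>
    rw [minPart, restPart]
    split_ifs
    · exact (ih x).cons x
    · exact List.perm_middle.trans ((ih m).cons x)

theorem restPart_sublist (m : ℕ) (l : List ℕ) : (restPart m l).Sublist l := by
  induction l generalizing m with
  | nil => exact List.Sublist.slnil
  | cons x l ih =>
    rw [restPart]
    split_ifs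
    · exact (ih x).cons x
    · exact (ih m).cons_cons x

theorem pairwise_cons_minPart (m : ℕ) (l : List ℕ) : (m :: minPart m l).Pairwise (· > ·) := by
  induction l generalizing m with
  | nil => simp [minPart]
  | cons x l ih =>
    rw [minPart]
    split_ifs with h
    · refine List.pairwise_cons.2 ⟨fun y hy => ?_, ih x⟩
      rcases List.mem_cons.1 hy with rfl | hy
      · exact h
      · exact (List.rel_of_pairwise_cons (ih x) hy).trans h
    · exact ih m

theorem eq_of_minMask_eq {m m' : ℕ} {l l' : List ℕ} (h1 : minMask m l = minMask m' l')
    (h2 : minPart m l = minPart m' l') (h3 : restPart m l = restPart m' l') : l = l' := by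
  induction l generalizing m m' l' with
  | nil =>
    have := congrArg List.length h1
    rw [length_minMask, length_minMask] at this
    exact (List.length_eq_zero_iff.1 this.symm).symm
  | cons x l ih =>
    cases l' with
    | nil =>
      have := congrArg List.length h1
      rw [length_minMask, length_minMask] at this
      simp at this
    | cons y l' =>
      simp only [minMask, minPart, restPart] at h1 h2 h3
      split_ifs at h1 h2 h3
      · obtain ⟨rfl, h2⟩ := List.cons_eq_cons.1 h2
        rw [ih (List.cons_eq_cons.1 h1).2 h2 h3]
      · simp at h1
      · simp at h1
      · obtain ⟨rfl, h4⟩ := List.cons_eq_cons.1 h3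
        rw [ih (List.cons_eq_cons.1 h1).2 h2 h4]

/-- Each entry that is not a left-to-right minimum has a smaller entry before it. -/
theorem exists_cons_sublist_of_sublist_restPart {m a : ℕ} {s l : List ℕ}
    (h : (a :: s).Sublist (restPart m l)) : ∃ e ≤ a, (e :: a :: s).Sublist (m :: l) := by
  induction l generalizing m with
  | nil => simp [restPart] at h
  | cons x l ih =>
    rw [restPart] at h
    split_ifs at h with hx
    · obtain ⟨e, he, hs⟩ := ih h
      exact ⟨e, he, hs.cons m⟩
    · rcases List.sublist_cons_iff.1 h with h | ⟨r, hr, h⟩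
      · obtain ⟨e, he, hs⟩ := ih h
        exact ⟨e, he, hs.trans ((List.sublist_cons_self x l).cons_cons m)⟩
      · obtain ⟨rfl, rfl⟩ := List.cons_eq_cons.1 hr
        exact ⟨m, not_lt.1 hx, ((h.trans (restPart_sublist m l)).cons_cons a).cons_cons m⟩

/-- `l` has no subsequence that is order-isomorphic to 12453. -/
def Avoids12453 (l : List ℕ) : Prop :=
  ∀ e a b c d, [e, a, b, c, d].Sublist l → e < a → a < d → d < b → ¬ b < c

theorem Avoids12453.restPart {n : ℕ} {l : List ℕ} (h : Avoids12453 l) (hl : l ∈ words (range n)) :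
    Avoids1342 (restPart n l) := by
  intro a b c d hs h1 h2 h3
  obtain ⟨hnd, hfin⟩ := mem_words.1 hl
  have ha : a < n := by
    rw [← mem_range, ← hfin, List.mem_toFinset]
    exact (restPart_sublist n l).subset (hs.subset (by simp))
  obtain ⟨e, he, hs'⟩ := exists_cons_sublist_of_sublist_restPart hs
  rcases List.sublist_cons_iff.1 hs' with hs' | ⟨r, hr, -⟩
  · refine h e a b c d hs' (lt_of_le_of_ne he ?_) h1 h2 h3
    rintro rfl
    have := hnd.sublist hs'
    simp at this
  · have := (List.cons_eq_cons.1 hr).1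
    omega

/-- The Boolean words of length `n` with `k` entries `true`. -/
def boolWords : ℕ → ℕ → Finset (List Bool)
  | 0, 0 => {[]}
  | 0, _ + 1 => ∅
  | n + 1, 0 => (boolWords n 0).image (false :: ·)
  | n + 1, k + 1 => (boolWords n k).image (true :: ·) ∪ (boolWords n (k + 1)).image (false :: ·)

theorem card_boolWords_le (n k : ℕ) : #(boolWords n k) ≤ n.choose k := by
  induction n generalizing k with
  | zero => cases k <;> simp [boolWords]
  | succ n ih =>
    cases k with
    | zero =>
      rw [boolWords]
      exact card_image_le.trans ((ih 0).trans (by simp))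
    | succ k =>
      rw [boolWords, Nat.choose_succ_succ]
      exact (card_union_le _ _).trans
        (add_le_add (card_image_le.trans (ih k)) (card_image_le.trans (ih (k + 1))))

theorem mem_boolWords (l : List Bool) : l ∈ boolWords l.length (l.count true) := by
  induction l with
  | nil => simp [boolWords]
  | cons x l ih =>
    cases x
    · rw [List.count_cons_of_ne (by simp), List.length_cons]
      cases hk : l.count true with
      | zero =>
        rw [boolWords]
        exact mem_image_of_mem _ (hk ▸ ih)
      | succ k =>
        rw [boolWords]
        exact mem_union_right _ (mem_image_of_mem _ (hk ▸ ih))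
    · rw [List.count_cons_self, List.length_cons, boolWords]
      exact mem_union_left _ (mem_image_of_mem _ ih)

open Classical in
theorem card_avoids12453_le_sum (n : ℕ) :
    (#{l ∈ words (range n) | Avoids12453 l} : ℝ) ≤
      ∑ k ∈ range (n + 1), (n.choose k : ℝ) * (n.choose k * (2 * 8 ^ (n - k))) := by
  let target : Finset ℕ → Finset (List Bool × Finset ℕ × List ℕ) := fun B =>
    boolWords n #B ×ˢ {B} ×ˢ {l ∈ words (range n \ B) | Avoids1342 l}
  have hcard : #{l ∈ words (range n) | Avoids12453 l} ≤
      #((range n).powerset.biUnion target) := by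
    refine card_le_card_of_injOn
      (fun l => (minMask n l, (minPart n l).toFinset, restPart n l)) ?_ ?_
    · intro l hl
      obtain ⟨hw, hav⟩ := mem_filter.1 hl
      have hperm := minPart_append_restPart_perm n l
      have hw' : minPart n l ++ restPart n l ∈ words (range n) := by
        obtain ⟨h1, h2⟩ := mem_words.1 hw
        exact mem_words.2 ⟨hperm.nodup_iff.2 h1, by rw [List.toFinset_eq_of_perm _ _ hperm, h2]⟩
      obtain ⟨h1, h2⟩ := mem_words.1 hw'
      have h3 := mem_boolWords (minMask n l)
      rw [length_minMask, count_minMask, length_of_mem_words hw, card_range] at h3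
      refine mem_biUnion.2 ⟨(minPart n l).toFinset, mem_powerset.2 ?_,
        mem_product.2 ⟨?_, mem_product.2 ⟨mem_singleton_self _, mem_filter.2
          ⟨mem_words_sdiff hw', hav.restPart hw⟩⟩⟩⟩
      · rw [← h2, List.toFinset_append]
        exact subset_union_left
      · rwa [List.toFinset_card_of_nodup (List.nodup_append'.1 h1).1]
    · intro l _ l' _ h
      simp only [Prod.mk.injEq] at h
      have hs := (List.pairwise_cons.1 (pairwise_cons_minPart n l)).2
      have hs' := (List.pairwise_cons.1 (pairwise_cons_minPart n l')).2
      refine eq_of_minMask_eq h.1 ?_ h.2.2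
      exact (List.perm_of_nodup_nodup_toFinset_eq (hs.imp fun h => h.ne')
        (hs'.imp fun h => h.ne') h.2.1).eq_of_pairwise' hs hs'
  have hsum : (#((range n).powerset.biUnion target) : ℝ) ≤
      ∑ B ∈ (range n).powerset, (n.choose #B : ℝ) * (2 * 8 ^ (n - #B)) := by
    refine (Nat.cast_le.2 card_biUnion_le).trans ?_
    rw [Nat.cast_sum]
    refine sum_le_sum fun B hB => ?_
    rw [card_product, card_product, card_singleton, one_mul, Nat.cast_mul]
    refine mul_le_mul (Nat.cast_le.2 (card_boolWords_le n #B)) ?_ (Nat.cast_nonneg _)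
      (Nat.cast_nonneg _)
    have := card_avoids1342_le (range n \ B)
    rwa [card_sdiff_of_subset (mem_powerset.1 hB), card_range] at this
  refine (Nat.cast_le.2 hcard).trans (hsum.trans_eq ?_)
  rw [Finset.sum_powerset_apply_card (fun k => (n.choose k : ℝ) * (2 * 8 ^ (n - k)))]
  simp [nsmul_eq_mul]

theorem sum_choose_sq_mul_le (n : ℕ) :
    ∑ k ∈ range (n + 1), (n.choose k : ℝ) * (n.choose k * (2 * 8 ^ (n - k))) ≤
      2 * (9 + 4 * √2) ^ n := by
  have h2 : √2 ^ 2 = 2 := Real.sq_sqrt (by norm_num)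
  have h8 : (2 * √2) ^ 2 = 8 := by rw [mul_pow, h2]; norm_num
  have hM : (9 + 4 * √2) = (1 + 2 * √2) ^ 2 := by linear_combination (-4 : ℝ) * h2
  have key := sum_sq_le_sq_sum_of_nonneg (s := range (n + 1))
    (f := fun k => (2 * √2) ^ (n - k) * (n.choose k : ℝ)) (fun i _ => by positivity)
  have hadd := add_pow (1 : ℝ) (2 * √2) n
  simp only [one_pow, one_mul] at hadd
  rw [← hadd, ← pow_mul, mul_comm n 2, pow_mul, ← hM] at key
  refine le_trans (le_of_eq ?_) (mul_le_mul_of_nonneg_left key zero_le_two)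
  rw [mul_sum]
  refine sum_congr rfl fun k _ => ?_
  rw [mul_pow, ← pow_mul, mul_comm (n - k) 2, pow_mul, h8]
  ring

theorem avoids12453_ofFn {n : ℕ} {p : Equiv.Perm (Fin n)} (hp : PermAvoids p pat12453) :
    Avoids12453 (List.ofFn fun i => (p i : ℕ)) := by
  intro e a b c d hs h1 h2 h3 h4
  obtain ⟨f, hf⟩ := List.sublist_iff_exists_fin_orderEmbedding_get_eq.1 hs
  refine hp ⟨fun i => Fin.cast (List.length_ofFn) (f i), fun i j hij => f.strictMono hij, ?_⟩
  have hv : ∀ i, ((p (Fin.cast (List.length_ofFn) (f i)) : Fin n) : ℕ) =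
      [e, a, b, c, d].get i := by
    intro i
    rw [hf i, List.get_ofFn]
  intro i j
  rw [Fin.lt_def, hv, hv]
  fin_cases i <;> fin_cases j <;> simp [pat12453] <;> omega

theorem avoiders_pat12453_le (n : ℕ) : (avoiders n pat12453 : ℝ) ≤ 2 * (9 + 4 * √2) ^ n := by
  classical
  refine le_trans (Nat.cast_le.2 ?_)
    ((card_avoids12453_le_sum n).trans (sum_choose_sq_mul_le n))
  rw [avoiders, ← Nat.card_eq_finsetCard]
  refine Nat.card_le_card_of_injective
    (fun p => ⟨List.ofFn fun i => (p.1 i : ℕ), mem_filter.2 ⟨mem_words.2 ⟨?_, ?_⟩,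
      avoids12453_ofFn p.2⟩⟩) ?_
  · exact List.nodup_ofFn.2 (Fin.val_injective.comp p.1.injective)
  · ext x
    simp only [List.mem_toFinset, List.mem_ofFn, mem_range]
    constructor
    · rintro ⟨i, rfl⟩
      exact (p.1 i).2
    · intro hx
      exact ⟨p.1.symm ⟨x, hx⟩, by simp⟩
  · intro p q hpq
    have h := List.ofFn_injective (Subtype.ext_iff.1 hpq)
    exact Subtype.ext (Equiv.ext fun i => Fin.ext (congrFun h i))

theorem tendsto_two_mul_pow_rpow {M : ℝ} (hM : 0 ≤ M) :
    Filter.Tendsto (fun n : ℕ => (2 * M ^ n) ^ (1 / (n : ℝ))) Filter.atTop (nhds M) := by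
  have h1 : Filter.Tendsto (fun n : ℕ => (2 : ℝ) ^ (1 / (n : ℝ)) * M) Filter.atTop (nhds M) := by
    have h2 : Filter.Tendsto (fun n : ℕ => (2 : ℝ) ^ (1 / (n : ℝ))) Filter.atTop
        (nhds ((2 : ℝ) ^ (0 : ℝ))) :=
      (Real.continuousAt_const_rpow (by norm_num)).tendsto.comp tendsto_one_div_atTop_nhds_zero_nat
    simpa using h2.mul_const M
  refine h1.congr' ?_
  filter_upwards [Filter.eventually_ne_atTop 0] with n hn
  rw [Real.mul_rpow zero_le_two (pow_nonneg hM n), one_div, Real.pow_rpow_inv_natCast hM hn]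

theorem limsup_rpow_le_of_le_two_mul_pow {u : ℕ → ℝ} {M : ℝ} (hu : ∀ n, 0 ≤ u n)
    (h : ∀ n, u n ≤ 2 * M ^ n) (hM : 0 ≤ M) :
    Filter.limsup (fun n : ℕ => u n ^ (1 / (n : ℝ))) Filter.atTop ≤ M := by
  have ht := tendsto_two_mul_pow_rpow hM
  rw [← ht.limsup_eq]
  refine Filter.limsup_le_limsup (Filter.Eventually.of_forall fun n =>
    Real.rpow_le_rpow (hu n) (h n) (by positivity)) ?_ ht.isBoundedUnder_le
  exact Filter.isCoboundedUnder_le_of_le (x := 0) _ fun n => Real.rpow_nonneg (hu n) _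

end

/-- The limsup of `(S_n(12453))^{1/n}` is at most `9 + 4√2`, and in particular
is less than `14.66`. -/
theorem limsup_12453_le :
    Filter.limsup (fun n : ℕ => (avoiders n pat12453 : ℝ) ^ (1 / (n : ℝ)))
        Filter.atTop ≤ 9 + 4 * Real.sqrt 2 ∧
    Filter.limsup (fun n : ℕ => (avoiders n pat12453 : ℝ) ^ (1 / (n : ℝ)))
        Filter.atTop < 14.66 := by
  have h := limsup_rpow_le_of_le_two_mul_pow (fun n => Nat.cast_nonneg (avoiders n pat12453))
    avoiders_pat12453_le (by positivity)
  have h2 : √2 < 1.4143 := (Real.sqrt_lt' (by norm_num)).2 (by norm_num)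
  exact ⟨h, h.trans_lt (by linarith)⟩
end
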